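/- Let D be a domain in ℂ and let A ⊆ D be a closed polar subset. Assume f is holomorphic on D \ A and f does not extend holomorphically to any point of A, i.e., for every a ∈ A there is no open neighborhood V ⊆ D of a and holomorphic g on V with g = f on V \ A. Then there exists a subset B ⊆ A which is dense in A such that (Γ_f)*_{D×ℂ} ∩ (B × ℂ) = ∅. -/

import Mathlib

open Set Metric MeasureTheory Filter Topology

noncomputable section

open Classical in
/-- The average of an `EReal`-valued function over the circle of center `z` and radius `r`;
it is `⊥` if the function equals `⊥` on a set of positive measure of the circle or if
its (finite) values are not integrable over the circle. -/
def circleAvg (u : ℂ → EReal) (z : ℂ) (r : ℝ) : EReal :=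
  if (IntervalIntegrable (fun θ : ℝ => (u (circleMap z r θ)).toReal) volume 0 (2 * Real.pi)
      ∧ ∀ᵐ θ ∂(volume.restrict (Set.Ioc (0:ℝ) (2 * Real.pi))), u (circleMap z r θ) ≠ ⊥)
  then (((∫ θ in (0:ℝ)..(2 * Real.pi), (u (circleMap z r θ)).toReal) / (2 * Real.pi) : ℝ) : EReal)
  else ⊥

/-- `u` is plurisubharmonic on a (typically open) set `Ω` of a complex vector space:
it takes values in `[-∞, ∞)`, is upper semicontinuous on `Ω`, is not identically `-∞`
on any connected component of `Ω`, and its restriction to every complex line satisfies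
the sub-mean value inequality on circles (whose closed discs lie in `Ω`). -/
def PSHOn {E : Type*} [NormedAddCommGroup E] [NormedSpace ℂ E]
    (u : E → EReal) (Ω : Set E) : Prop :=
  (∀ z ∈ Ω, u z ≠ ⊤) ∧
  UpperSemicontinuousOn u Ω ∧
  (∀ z ∈ Ω, ∃ w ∈ connectedComponentIn Ω z, u w ≠ ⊥) ∧
  ∀ a b : E, ∀ c : ℂ, ∀ r : ℝ, 0 < r →
    (∀ l ∈ Metric.closedBall c r, a + l • b ∈ Ω) →
    u (a + c • b) ≤ circleAvg (fun l : ℂ => u (a + l • b)) c r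

/-- In one complex variable, plurisubharmonic = subharmonic. -/
abbrev SubharmonicOn (u : ℂ → EReal) (Ω : Set ℂ) : Prop := PSHOn u Ω

/-- A set `P ⊆ ℂ` is polar if `P ⊆ {u = -∞}` for some subharmonic `u` on `ℂ`
(not identically `-∞`). -/
def PolarSet (P : Set ℂ) : Prop :=
  ∃ u : ℂ → EReal, SubharmonicOn u Set.univ ∧ ∀ z ∈ P, u z = ⊥

/-- `S` is pluripolar in `Ω`. -/
def PluripolarIn {E : Type*} [NormedAddCommGroup E] [NormedSpace ℂ E]
    (S Ω : Set E) : Prop :=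
  ∃ u : E → EReal, PSHOn u Ω ∧ ∀ z ∈ S, u z = ⊥

/-- `S` is complete pluripolar in `Ω`: `S` is exactly the `-∞`-set of some
plurisubharmonic function on `Ω`. -/
def CompletePluripolarIn {E : Type*} [NormedAddCommGroup E] [NormedSpace ℂ E]
    (S Ω : Set E) : Prop :=
  ∃ u : E → EReal, PSHOn u Ω ∧ ∀ z ∈ Ω, (u z = ⊥ ↔ z ∈ S)

/-- The pluripolar hull `S*_Ω` of `S` in `Ω`. -/
def pluripolarHull {E : Type*} [NormedAddCommGroup E] [NormedSpace ℂ E]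
    (S Ω : Set E) : Set E :=
  {z ∈ Ω | ∀ u : E → EReal, PSHOn u Ω → (∀ w ∈ S, u w = ⊥) → u z = ⊥}

/-- `S` is (pluri-)thin at `ζ`: either `ζ` is not a limit point of `S \ {ζ}`, or there is
a plurisubharmonic function on a neighborhood of `ζ` with
`limsup_{z → ζ, z ∈ S \ {ζ}} u z < u ζ`. -/
def PluriThinAt {E : Type*} [NormedAddCommGroup E] [NormedSpace ℂ E]
    (S : Set E) (ζ : E) : Prop :=
  ζ ∉ closure (S \ {ζ}) ∨
  ∃ U : Set E, IsOpen U ∧ ζ ∈ U ∧ ∃ u : E → EReal, PSHOn u U ∧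
    Filter.limsup u (nhdsWithin ζ (S \ {ζ})) < u ζ

/-- Thinness in `ℂ`. -/
abbrev ThinAt (S : Set ℂ) (ζ : ℂ) : Prop := PluriThinAt S ζ

/-- The relative extremal function (pluriharmonic measure) `ω(z, A, D)`:
`-sup { u(z) : u` psh on `D`, `u ≤ 0` on `D`, `u ≤ -1` on `A }`, where for points of `A`
not belonging to `D` the condition `u ≤ -1` is understood as
`limsup_{ζ → w, ζ ∈ D} u(ζ) ≤ -1` (for `w ∈ A ∩ D` and `u` upper semicontinuous the
condition below is equivalent to `u w ≤ -1`). -/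
def relExtremal {E : Type*} [NormedAddCommGroup E] [NormedSpace ℂ E]
    (z : E) (A D : Set E) : EReal :=
  - sSup {y : EReal | ∃ u : E → EReal, PSHOn u D ∧ (∀ w ∈ D, u w ≤ 0) ∧
      (∀ w ∈ A, Filter.limsup u (nhdsWithin w (insert w D)) ≤ -1) ∧ y = u z}

/-- `ζ` is a regular boundary point of `Ω` if `ζ ∈ ∂Ω` and `ℂ \ Ω` is non-thin at `ζ`. -/
def RegularBoundaryPoint (Ω : Set ℂ) (ζ : ℂ) : Prop :=
  ζ ∈ frontier Ω ∧ ¬ ThinAt Ωᶜ ζ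

/-- The graph `Γ_f = {(z, f z) : z ∈ S} ⊆ ℂ²` of `f` over `S`. -/
def graphOver (f : ℂ → ℂ) (S : Set ℂ) : Set (ℂ × ℂ) := {p | p.1 ∈ S ∧ p.2 = f p.1}

/-- `e^x` for `x ∈ [-∞, ∞)`, as a map to `[0, ∞)`. -/
def expEReal (x : EReal) : ℝ := if x = ⊥ then 0 else Real.exp x.toReal

end

section
open Set Metric MeasureTheory Filter Topology
namespace PH

section LSMsec
variable {E : Type*} [NormedAddCommGroup E] [NormedSpace ℂ E]

/-- Local sub-mean value property at `p` (along all complex lines), with continuity near `p`. -/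
def LSM (v : E → ℝ) (p : E) : Prop :=
  (∀ᶠ q in 𝓝 p, ContinuousAt v q) ∧
  ∀ b : E, ∀ᶠ r in 𝓝[>] (0:ℝ), v p ≤ Real.circleAverage (fun l : ℂ => v (p + l • b)) 0 r

lemma line_ev {P : E → Prop} {p : E} (h : ∀ᶠ q in 𝓝 p, P q) (b : E) :
    ∀ᶠ r in 𝓝[>] (0:ℝ), 0 < r ∧ ∀ l ∈ closedBall (0:ℂ) r, P (p + l • b) := by
  have hc : Tendsto (fun l : ℂ => p + l • b) (𝓝 0) (𝓝 p) := by
    have : Continuous (fun l : ℂ => p + l • b) := by fun_prop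
    simpa using this.tendsto 0
  obtain ⟨δ, hδ, hball⟩ := Metric.eventually_nhds_iff_ball.1 (hc.eventually h)
  filter_upwards [Ioo_mem_nhdsGT hδ] with r hr
  refine ⟨hr.1, fun l hl => hball l ?_⟩
  rw [mem_closedBall] at hl
  rw [mem_ball]; exact lt_of_le_of_lt hl hr.2

lemma line_cont {v : E → ℝ} {p : E} (h : ∀ᶠ q in 𝓝 p, ContinuousAt v q) (b : E) :
    ∀ᶠ r in 𝓝[>] (0:ℝ), CircleIntegrable (fun l : ℂ => v (p + l • b)) 0 r := by
  filter_upwards [line_ev h b] with r hr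
  apply ContinuousOn.circleIntegrable hr.1.le
  intro l hl
  apply ContinuousAt.continuousWithinAt
  exact ContinuousAt.comp (f := fun l : ℂ => p + l • b) (hr.2 l (sphere_subset_closedBall hl))
    (by fun_prop)

lemma LSM.of_minorant {m v : E → ℝ} {p : E} (hm : LSM m p) (hp : m p = v p)
    (hle : ∀ᶠ q in 𝓝 p, m q ≤ v q) (hv : ∀ᶠ q in 𝓝 p, ContinuousAt v q) : LSM v p := by
  refine ⟨hv, fun b => ?_⟩
  filter_upwards [hm.2 b, line_cont hv b, line_cont hm.1 b, line_ev hle b] with r h1 h2 h3 h4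
  rw [← hp]
  refine h1.trans (Real.circleAverage_mono h3 h2 ?_)
  intro l hl
  rw [abs_of_pos h4.1] at hl
  exact h4.2 l (sphere_subset_closedBall hl)

lemma LSM.congr {m v : E → ℝ} {p : E} (hm : LSM m p) (h : v =ᶠ[𝓝 p] m) : LSM v p := by
  refine hm.of_minorant h.self_of_nhds.symm (h.mono fun q hq => hq.symm.le) ?_
  filter_upwards [h.eventually_nhds, hm.1] with q hq hc
  exact hc.congr (EventuallyEq.symm hq)

lemma LSM.max {u v : E → ℝ} {p : E} (hu : LSM u p) (hv : LSM v p) :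
    LSM (fun q => max (u q) (v q)) p := by
  have hc : ∀ᶠ q in 𝓝 p, ContinuousAt (fun q => Max.max (u q) (v q)) q := by
    filter_upwards [hu.1, hv.1] with q h1 h2 using h1.max h2
  rcases le_total (u p) (v p) with h | h
  · exact hv.of_minorant (by simp [h]) (Eventually.of_forall fun q => le_max_right _ _) hc
  · exact hu.of_minorant (by simp [h]) (Eventually.of_forall fun q => le_max_left _ _) hc

lemma LSM.add {u v : E → ℝ} {p : E} (hu : LSM u p) (hv : LSM v p) :
    LSM (fun q => u q + v q) p := by
  refine ⟨by filter_upwards [hu.1, hv.1] with q h1 h2 using h1.add h2, fun b => ?_⟩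
  filter_upwards [hu.2 b, hv.2 b, line_cont hu.1 b, line_cont hv.1 b] with r h1 h2 h3 h4
  rw [Real.circleAverage_fun_add h3 h4]
  linarith

lemma LSM.const (c : ℝ) (p : E) : LSM (fun _ => c) p :=
  ⟨Eventually.of_forall fun q => continuousAt_const, fun b => Eventually.of_forall fun r => by
    rw [Real.circleAverage_const]⟩

lemma LSM.const_mul {u : E → ℝ} {p : E} (hu : LSM u p) {c : ℝ} (hc : 0 ≤ c) :
    LSM (fun q => c * u q) p := by
  refine ⟨by filter_upwards [hu.1] with q h1 using continuousAt_const.mul h1, fun b => ?_⟩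
  filter_upwards [hu.2 b] with r h1
  have := Real.circleAverage_fun_smul (f := fun l : ℂ => u (p + l • b)) (c := 0) (R := r) (a := c)
  simp only [smul_eq_mul] at this
  rw [this]
  exact mul_le_mul_of_nonneg_left h1 hc

lemma LSM.sum {ι : Type*} (s : Finset ι) {u : ι → E → ℝ} {p : E} (hu : ∀ i ∈ s, LSM (u i) p) :
    LSM (fun q => ∑ i ∈ s, u i q) p := by
  classical
  induction s using Finset.induction_on with
  | empty => simpa using LSM.const 0 p
  | insert i s hi ih =>
    simp only [Finset.sum_insert hi]
    exact (hu i (Finset.mem_insert_self _ _)).add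
      (ih fun j hj => hu j (Finset.mem_insert_of_mem hj))

lemma LSM.comp_fst {g : ℂ → ℝ} {p : ℂ × ℂ} (hg : LSM g p.1) : LSM (fun q : ℂ × ℂ => g q.1) p := by
  refine ⟨?_, fun b => ?_⟩
  · have := (continuous_fst.tendsto p).eventually hg.1
    filter_upwards [this] with q hq
    exact ContinuousAt.comp (f := Prod.fst) hq continuousAt_fst
  · simpa using hg.2 b.1

lemma LSM.comp_snd {g : ℂ → ℝ} {p : ℂ × ℂ} (hg : LSM g p.2) : LSM (fun q : ℂ × ℂ => g q.2) p := by
  refine ⟨?_, fun b => ?_⟩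
  · have := (continuous_snd.tendsto p).eventually hg.1
    filter_upwards [this] with q hq
    exact ContinuousAt.comp (f := Prod.snd) hq continuousAt_snd
  · simpa using hg.2 b.2

/-- `log ‖h‖` has the mean value property where `h` is holomorphic and nonzero. -/
lemma log_mean {h : E → ℂ} {p : E} (hd : ∀ᶠ q in 𝓝 p, DifferentiableAt ℂ h q) (hp : h p ≠ 0)
    (b : E) : ∀ᶠ r in 𝓝[>] (0:ℝ),
      Real.circleAverage (fun l : ℂ => Real.log ‖h (p + l • b)‖) 0 r = Real.log ‖h p‖ := by
  have hne : ∀ᶠ q in 𝓝 p, h q ≠ 0 := hd.self_of_nhds.continuousAt.eventually_ne hp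
  filter_upwards [line_ev (hd.eventually_nhds.and hne) b] with r hr
  have hh : InnerProductSpace.HarmonicOnNhd (fun l : ℂ => Real.log ‖h (p + l • b)‖)
      (closedBall (0:ℂ) |r|) := by
    rw [abs_of_pos hr.1]
    intro l hl
    obtain ⟨h1, h2⟩ := hr.2 l hl
    apply AnalyticAt.harmonicAt_log_norm (f := fun l : ℂ => h (p + l • b)) _ h2
    rw [Complex.analyticAt_iff_eventually_differentiableAt]
    have hc : ContinuousAt (fun l : ℂ => p + l • b) l := by fun_prop
    filter_upwards [hc.eventually h1] with l' hl'
    exact DifferentiableAt.comp l' (f := fun l : ℂ => p + l • b) hl' (by fun_prop)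
  have := hh.circleAverage_eq
  simpa using this

lemma LSM.log_norm {h : E → ℂ} {p : E} (hd : ∀ᶠ q in 𝓝 p, DifferentiableAt ℂ h q) (hp : h p ≠ 0) :
    LSM (fun q => Real.log ‖h q‖) p := by
  have hne : ∀ᶠ q in 𝓝 p, h q ≠ 0 := hd.self_of_nhds.continuousAt.eventually_ne hp
  refine ⟨?_, fun b => (log_mean hd hp b).mono fun r hr => hr.ge⟩
  filter_upwards [hd, hne] with q h1 h2
  exact h1.continuousAt.norm.log (by simpa using h2)

lemma LSM.neg_log_norm {h : E → ℂ} {p : E} (hd : ∀ᶠ q in 𝓝 p, DifferentiableAt ℂ h q)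
    (hp : h p ≠ 0) : LSM (fun q => - Real.log ‖h q‖) p := by
  refine ⟨(LSM.log_norm hd hp).1.mono fun q hq => hq.neg, fun b => ?_⟩
  filter_upwards [log_mean hd hp b] with r hr
  have := Real.circleAverage_fun_smul (f := fun l : ℂ => Real.log ‖h (p + l • b)‖) (c := 0)
    (R := r) (a := (-1:ℝ))
  simp only [smul_eq_mul, neg_mul, one_mul] at this
  rw [this, hr]

lemma LSM.log_max {h : E → ℂ} {p : E} (hd : ∀ᶠ q in 𝓝 p, DifferentiableAt ℂ h q) {c : ℝ}
    (hc : 0 < c) : LSM (fun q => Real.log (Max.max ‖h q‖ c)) p := by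
  rcases lt_or_ge ‖h p‖ c with h1 | h1
  · refine (LSM.const (Real.log c) p).congr ?_
    filter_upwards [hd.self_of_nhds.continuousAt.norm.eventually_lt_const h1] with q hq
    simp [hq.le]
  · have hp : h p ≠ 0 := by
      intro h0; rw [h0, norm_zero] at h1; linarith
    refine ((LSM.log_norm hd hp).max (LSM.const (Real.log c) p)).congr ?_
    have hne : ∀ᶠ q in 𝓝 p, h q ≠ 0 := hd.self_of_nhds.continuousAt.eventually_ne hp
    filter_upwards [hne] with q hq
    have hq' : 0 < ‖h q‖ := norm_pos_iff.2 hq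
    rcases le_total ‖h q‖ c with h2 | h2
    · rw [max_eq_right h2, max_eq_right (Real.log_le_log hq' h2)]
    · rw [max_eq_left h2, max_eq_left (Real.log_le_log hc h2)]

lemma LSM.norm {h : E → ℂ} {p : E} (hd : ∀ᶠ q in 𝓝 p, DifferentiableAt ℂ h q) :
    LSM (fun q => ‖h q‖) p := by
  refine ⟨hd.mono fun q hq => hq.continuousAt.norm, fun b => ?_⟩
  filter_upwards [line_ev hd b] with r hr
  have hdiff : ∀ l ∈ closedBall (0:ℂ) r, DifferentiableAt ℂ (fun l : ℂ => h (p + l • b)) l :=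
    fun l hl => DifferentiableAt.comp l (f := fun l : ℂ => p + l • b) (hr.2 l hl) (by fun_prop)
  have h1 : Real.circleAverage (fun l : ℂ => h (p + l • b)) 0 r = h p := by
    have := circleAverage_of_differentiable_on_off_countable (f := fun l : ℂ => h (p + l • b))
      (c := 0) (R := r) (s := ∅) countable_empty
      (by rw [abs_of_pos hr.1]; exact fun l hl => (hdiff l hl).continuousAt.continuousWithinAt)
      (by rw [abs_of_pos hr.1]; exact fun l hl => hdiff l (ball_subset_closedBall hl.1))
    simpa using this
  rw [← h1]
  unfold Real.circleAverage
  rw [norm_smul, smul_eq_mul, Real.norm_of_nonneg (by positivity)]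
  gcongr
  exact intervalIntegral.norm_integral_le_integral_norm Real.two_pi_pos.le

end LSMsec

lemma avg_re {G : ℂ → ℂ} (hG : Differentiable ℂ G) (r : ℝ) :
    Real.circleAverage (fun l => (G l).re) 0 r = (G 0).re := by
  have h1 : CircleIntegrable G 0 r := hG.continuous.continuousOn.circleIntegrable'
  have h2 := Complex.reCLM.circleAverage_comp_comm h1
  have h3 : Real.circleAverage G 0 r = G 0 := hG.diffContOnCl.circleAverage
  rw [h3] at h2
  exact h2

lemma avg_sq (p : ℂ) (r : ℝ) :
    Real.circleAverage (fun l : ℂ => ‖p + l‖ ^ 2) 0 r = ‖p‖ ^ 2 + r ^ 2 := by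
  have h : Real.circleAverage (fun l : ℂ => ‖p + l‖ ^ 2) 0 r =
      Real.circleAverage (fun l : ℂ => (((‖p‖ ^ 2 + r ^ 2 : ℝ) : ℂ) +
        2 * (starRingEnd ℂ p) * l).re) 0 r := by
    apply Real.circleAverage_congr_sphere
    intro l hl
    have hl' : ‖l‖ = |r| := by simpa using hl
    have : ‖l‖ ^ 2 = r ^ 2 := by rw [hl', sq_abs]
    simp only [Complex.add_re, Complex.ofReal_re]
    rw [← this, ← Complex.normSq_eq_norm_sq, ← Complex.normSq_eq_norm_sq,
      ← Complex.normSq_eq_norm_sq]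
    simp [Complex.normSq_apply]; ring
  rw [h, avg_re (by fun_prop), mul_zero, add_zero, Complex.ofReal_re]

end PH
end

section
open Set Metric MeasureTheory Filter Topology
namespace PH

lemma LSM.line {E : Type*} [NormedAddCommGroup E] [NormedSpace ℂ E] {v : E → ℝ} {a b : E} {z : ℂ}
    (h : LSM v (a + z • b)) : LSM (fun l : ℂ => v (a + l • b)) z := by
  have hc : Continuous (fun l : ℂ => a + l • b) := by fun_prop
  refine ⟨?_, fun b' => ?_⟩
  · filter_upwards [(hc.tendsto z).eventually h.1] with q hq
    exact ContinuousAt.comp (f := fun l : ℂ => a + l • b) hq hc.continuousAt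
  · filter_upwards [h.2 (b' • b)] with r hr
    refine hr.trans (le_of_eq ?_)
    congr 1
    funext l
    congr 1
    rw [smul_eq_mul, add_smul, mul_smul, add_assoc]

lemma trig_form (g : C(AddCircle (2 * Real.pi), ℂ))
    (hg : g ∈ Submodule.span ℂ (range (@fourier (2 * Real.pi)))) :
    ∃ P Q : Polynomial ℂ, ∀ x : AddCircle (2 * Real.pi),
      g x = P.eval (AddCircle.toCircle x : ℂ) +
        (starRingEnd ℂ) (Q.eval (AddCircle.toCircle x : ℂ)) := by
  induction hg using Submodule.span_induction with
  | mem g hg =>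
    obtain ⟨n, rfl⟩ := hg
    rcases n with n | n
    · refine ⟨Polynomial.X ^ n, 0, fun x => ?_⟩
      simp [fourier_apply, AddCircle.toCircle_nsmul]
    · refine ⟨0, Polynomial.X ^ (n+1), fun x => ?_⟩
      have h2 : (AddCircle.toCircle (Int.negSucc n • x) : ℂ) =
          (AddCircle.toCircle ((n + 1) • x) : ℂ)⁻¹ := by
        rw [negSucc_zsmul, AddCircle.toCircle_neg]; simp
      rw [fourier_apply, h2, AddCircle.toCircle_nsmul]
      simp only [Circle.coe_pow, Polynomial.eval_zero, zero_add, Polynomial.eval_pow,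
        Polynomial.eval_X, map_pow]
      rw [← inv_pow, ← Circle.coe_inv, Circle.coe_inv_eq_conj]
  | zero => exact ⟨0, 0, fun x => by simp⟩
  | add g1 g2 _ _ h1 h2 =>
    obtain ⟨P1, Q1, h1⟩ := h1
    obtain ⟨P2, Q2, h2⟩ := h2
    refine ⟨P1 + P2, Q1 + Q2, fun x => ?_⟩
    simp only [ContinuousMap.add_apply, h1, h2, Polynomial.eval_add, map_add]
    ring
  | smul a g _ h =>
    obtain ⟨P, Q, h⟩ := h
    refine ⟨Polynomial.C a * P, Polynomial.C (starRingEnd ℂ a) * Q, fun x => ?_⟩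
    simp only [ContinuousMap.smul_apply, h, Polynomial.eval_mul, Polynomial.eval_C, map_mul,
      Complex.conj_conj, smul_eq_mul]
    ring

lemma harm_approx {v : ℂ → ℝ} {c : ℂ} {r : ℝ} (hr : 0 < r) (hv : ContinuousOn v (sphere c r))
    {ε : ℝ} (hε : 0 < ε) : ∃ G : ℂ → ℂ, Differentiable ℂ G ∧
      ∀ z ∈ sphere c r, |v z - (G z).re| ≤ ε := by
  have : Fact (0 < 2 * Real.pi) := ⟨Real.two_pi_pos⟩
  have hcont : Continuous (fun x : AddCircle (2 * Real.pi) =>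
      ((v (c + r * (AddCircle.toCircle x : ℂ)) : ℝ) : ℂ)) := by
    apply Complex.continuous_ofReal.comp
    apply hv.comp_continuous
    · have := AddCircle.continuous_toCircle (T := 2 * Real.pi)
      fun_prop
    · intro x
      simp [abs_of_pos hr, Circle.norm_coe]
  let φ : C(AddCircle (2 * Real.pi), ℂ) := ⟨_, hcont⟩
  have hφ : φ ∈ (Submodule.span ℂ (range (@fourier (2 * Real.pi)))).topologicalClosure := by
    rw [span_fourier_closure_eq_top]; trivial
  rw [← SetLike.mem_coe, Submodule.topologicalClosure_coe, Metric.mem_closure_iff] at hφ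
  obtain ⟨g, hg, hdist⟩ := hφ ε hε
  obtain ⟨P, Q, hPQ⟩ := trig_form g hg
  refine ⟨fun z => (P + Q).eval ((z - c) / r), ?_, ?_⟩
  · have := (P + Q).differentiable
    exact this.comp (by fun_prop)
  · intro z hz
    have hr' : (r : ℂ) ≠ 0 := by exact_mod_cast hr.ne'
    have hu : ‖(z - c) / r‖ = 1 := by
      rw [norm_div, Complex.norm_real, Real.norm_of_nonneg hr.le, mem_sphere_iff_norm.1 hz,
        div_self hr.ne']
    obtain ⟨x, hx⟩ := (AddCircle.homeomorphCircle (T := 2 * Real.pi) (by positivity)).surjective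
      (⟨(z - c) / r, by simpa [Submonoid.unitSphere] using hu⟩ : Circle)
    have hx' : (AddCircle.toCircle x : ℂ) = (z - c) / r := by
      rw [AddCircle.homeomorphCircle_apply] at hx
      rw [hx]
    have h1 : ‖φ x - g x‖ ≤ ε := by
      rw [← dist_eq_norm]
      exact (ContinuousMap.dist_apply_le_dist x).trans hdist.le
    have h2 : φ x = ((v z : ℝ) : ℂ) := by
      change ((v (c + r * (AddCircle.toCircle x : ℂ)) : ℝ) : ℂ) = _
      rw [hx']
      congr 2
      field_simp
      ring
    have h3 := (Complex.abs_re_le_norm _).trans h1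
    rw [h2, hPQ, hx'] at h3
    simpa [Polynomial.eval_add] using h3

lemma lsm_max_principle {v : ℂ → ℝ} {c : ℂ} {r : ℝ} (hr : 0 < r)
    (hv : ∀ z ∈ closedBall c r, LSM v z) {G : ℂ → ℂ} (hG : Differentiable ℂ G)
    (hb : ∀ z ∈ sphere c r, v z ≤ (G z).re) : v c ≤ (G c).re := by
  by_contra hcon
  push Not at hcon
  obtain ⟨δ, hδ, hδ2⟩ : ∃ δ > 0, δ * r ^ 2 < v c - (G c).re := by
    refine ⟨(v c - (G c).re) / (2 * r ^ 2), by have := sub_pos.2 hcon; positivity, ?_⟩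
    have := sub_pos.2 hcon
    field_simp; linarith
  let F : ℂ → ℝ := fun z => v z - (G z).re + δ * ‖z - c‖ ^ 2
  have hGc := hG.continuous
  have hvc : ∀ z ∈ closedBall c r, ContinuousAt v z := fun z hz => (hv z hz).1.self_of_nhds
  have hFc : ContinuousOn F (closedBall c r) := by
    apply ContinuousOn.add
    · apply ContinuousOn.sub (fun z hz => (hvc z hz).continuousWithinAt)
      exact (Complex.continuous_re.comp hGc).continuousOn
    · fun_prop
  obtain ⟨z, hz, hmax⟩ := (isCompact_closedBall c r).exists_isMaxOn
    ⟨c, mem_closedBall_self hr.le⟩ hFc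
  have hFz : v c - (G c).re ≤ F z := by
    have := hmax (mem_closedBall_self hr.le)
    simpa [F] using this
  have hzb : z ∈ ball c r := by
    by_contra hzn
    have hzs : z ∈ sphere c r := by
      rw [mem_closedBall] at hz; rw [mem_ball, not_lt] at hzn; exact le_antisymm hz hzn
    have h1 := hb z hzs
    have : F z ≤ δ * r ^ 2 := by
      simp only [F]
      rw [mem_sphere_iff_norm.1 hzs]; linarith
    linarith
  have hnb : ∀ᶠ q in 𝓝 z, q ∈ closedBall c r :=
    mem_of_superset (isOpen_ball.mem_nhds hzb) ball_subset_closedBall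
  obtain ⟨ρ, h1, h2, h3⟩ := (((hv z hz).2 1).and ((line_cont (hv z hz).1 1).and
    (line_ev hnb 1))).exists
  simp only [smul_eq_mul, mul_one] at h1 h2 h3
  have hG2 : Differentiable ℂ (fun l => G (z + l)) := hG.comp (by fun_prop)
  have hi2 : CircleIntegrable (fun l => (G (z + l)).re) 0 ρ :=
    (Complex.continuous_re.comp hG2.continuous).continuousOn.circleIntegrable'
  have hi3 : CircleIntegrable (fun l => δ * ‖z - c + l‖ ^ 2) 0 ρ := by
    apply ContinuousOn.circleIntegrable'; fun_prop
  have e1 : Real.circleAverage (fun l => (v (z + l) - (G (z + l)).re) + δ * ‖z - c + l‖ ^ 2) 0 ρ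
      ≤ F z := by
    apply Real.circleAverage_mono_on_of_le_circle ((h2.sub hi2).add hi3)
    intro l hl
    rw [abs_of_pos h3.1] at hl
    have := hmax (h3.2 l (sphere_subset_closedBall hl))
    have e : z - c + l = z + l - c := by ring
    show v (z + l) - (G (z + l)).re + δ * ‖z - c + l‖ ^ 2 ≤ F z
    rw [e]
    exact this
  rw [Real.circleAverage_fun_add (f₁ := fun l => v (z + l) - (G (z + l)).re) (h2.sub hi2) hi3,
    Real.circleAverage_fun_sub h2 hi2, avg_re hG2] at e1
  have e2 := Real.circleAverage_fun_smul (f := fun l : ℂ => ‖z - c + l‖ ^ 2) (c := 0) (R := ρ)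
    (a := δ)
  simp only [smul_eq_mul] at e2
  rw [e2, avg_sq] at e1
  simp only [F, add_zero] at e1
  have : 0 < δ * ρ ^ 2 := by have := h3.1; positivity
  nlinarith

theorem submean_global {v : ℂ → ℝ} {c : ℂ} {r : ℝ} (hr : 0 < r)
    (hv : ∀ z ∈ closedBall c r, LSM v z) : v c ≤ Real.circleAverage v c r := by
  apply le_of_forall_pos_le_add
  intro ε hε
  have hvc : ContinuousOn v (sphere c r) := fun z hz =>
    (hv z (sphere_subset_closedBall hz)).1.self_of_nhds.continuousWithinAt
  obtain ⟨G, hG, hGv⟩ := harm_approx hr hvc (half_pos hε)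
  have h1 := lsm_max_principle hr hv (G := fun z => G z + ((ε / 2 : ℝ) : ℂ)) (by fun_prop)
    (fun z hz => by
      have := (abs_le.1 (hGv z hz)).2
      rw [Complex.add_re, Complex.ofReal_re]; linarith)
  rw [Complex.add_re, Complex.ofReal_re] at h1
  have hGi : CircleIntegrable (fun z => (G z).re) c r :=
    (Complex.continuous_re.comp hG.continuous).continuousOn.circleIntegrable'
  have hvi : CircleIntegrable v c r := hvc.circleIntegrable hr.le
  have h2 : Real.circleAverage (fun z => (G z).re) c r = (G c).re := by
    have a1 : CircleIntegrable G c r := hG.continuous.continuousOn.circleIntegrable'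
    have a2 := Complex.reCLM.circleAverage_comp_comm a1
    have a3 : Real.circleAverage G c r = G c := hG.diffContOnCl.circleAverage
    rw [a3] at a2
    exact a2
  have h3 : Real.circleAverage (fun z => (G z).re) c r ≤
      Real.circleAverage (fun z => v z + ε / 2) c r := by
    apply Real.circleAverage_mono hGi (hvi.add (circleIntegrable_const _ _ _))
    intro z hz
    rw [abs_of_pos hr] at hz
    have := (abs_le.1 (hGv z hz)).1
    show (G z).re ≤ v z + ε / 2
    linarith
  rw [Real.circleAverage_fun_add hvi (circleIntegrable_const _ _ _), Real.circleAverage_const] at h3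
  linarith

end PH
end

section
open Set Metric MeasureTheory Filter Topology
namespace PH

lemma mono_conv {μ : Measure ℝ} {F : ℕ → ℝ → ℝ} (hm : ∀ n, Measurable (F n))
    (hF : ∀ n, Integrable (F n) μ) (ha : ∀ θ, Antitone fun n => F n θ) {u : ℝ → EReal}
    (hu : ∀ θ, Tendsto (fun n => ((F n θ : ℝ) : EReal)) atTop (𝓝 (u θ))) {x : ℝ}
    (hx : ∀ n, x ≤ ∫ θ, F n θ ∂μ) :
    (∀ᵐ θ ∂μ, u θ ≠ ⊥) ∧ Integrable (fun θ => (u θ).toReal) μ ∧ x ≤ ∫ θ, (u θ).toReal ∂μ := by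
  have hle : ∀ n θ, u θ ≤ F n θ := fun n θ => by
    refine le_of_tendsto (hu θ) (eventually_atTop.2 ⟨n, fun k hk => ?_⟩)
    exact EReal.coe_le_coe_iff.2 (ha θ hk)
  have hbd : ∀ n, ∫⁻ θ, ENNReal.ofReal (F 0 θ - F n θ) ∂μ ≤ ENNReal.ofReal (∫ θ, F 0 θ ∂μ - x) := by
    intro n
    rw [← ofReal_integral_eq_lintegral_ofReal (f := fun θ => F 0 θ - F n θ) ((hF 0).sub (hF n))
      (ae_of_all _ fun θ => sub_nonneg.2 (ha θ (Nat.zero_le n)))]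
    apply ENNReal.ofReal_le_ofReal
    have := integral_sub (hF 0) (hF n)
    rw [this]
    linarith [hx n]
  have hsup : ∫⁻ θ, ⨆ n, ENNReal.ofReal (F 0 θ - F n θ) ∂μ ≤ ENNReal.ofReal (∫ θ, F 0 θ ∂μ - x) := by
    rw [lintegral_iSup (f := fun n θ => ENNReal.ofReal (F 0 θ - F n θ)) (fun n => ((hm 0).sub (hm n)).ennreal_ofReal)]
    · exact iSup_le hbd
    · intro i j hij θ
      exact ENNReal.ofReal_le_ofReal (sub_le_sub_left (ha θ hij) _)
  have hae : ∀ᵐ θ ∂μ, ⨆ n, ENNReal.ofReal (F 0 θ - F n θ) < ⊤ := by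
    apply ae_lt_top (Measurable.iSup fun n => ((hm 0).sub (hm n)).ennreal_ofReal)
    exact (hsup.trans_lt ENNReal.ofReal_lt_top).ne
  have hbot : ∀ᵐ θ ∂μ, u θ ≠ ⊥ := by
    filter_upwards [hae] with θ hθ hb
    set B := (⨆ n, ENNReal.ofReal (F 0 θ - F n θ)).toReal
    have h1 : ∀ n, F 0 θ - B ≤ F n θ := by
      intro n
      have : ENNReal.ofReal (F 0 θ - F n θ) ≤ ⨆ n, ENNReal.ofReal (F 0 θ - F n θ) :=
        le_iSup (fun n => ENNReal.ofReal (F 0 θ - F n θ)) n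
      have h2 := ENNReal.toReal_mono hθ.ne this
      rw [ENNReal.toReal_ofReal (sub_nonneg.2 (ha θ (Nat.zero_le n)))] at h2
      linarith
    have h2 : ((F 0 θ - B : ℝ) : EReal) ≤ u θ :=
      ge_of_tendsto (hu θ) (Eventually.of_forall fun n => EReal.coe_le_coe_iff.2 (h1 n))
    rw [hb] at h2
    exact absurd h2 (not_le.2 (EReal.bot_lt_coe (F 0 θ - B)))
  have htop : ∀ θ, u θ ≠ ⊤ := fun θ h => by
    have := hle 0 θ; rw [h] at this; exact absurd this (by simp)
  have hlim : ∀ᵐ θ ∂μ, Tendsto (fun n => F n θ) atTop (𝓝 (u θ).toReal) := by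
    filter_upwards [hbot] with θ hθ
    have := hu θ
    rw [← EReal.coe_toReal (htop θ) hθ] at this
    exact EReal.tendsto_coe.1 this
  have hler : ∀ᵐ θ ∂μ, ∀ n, (u θ).toReal ≤ F n θ := by
    filter_upwards [hbot] with θ hθ n
    have := hle n θ
    rw [← EReal.coe_toReal (htop θ) hθ] at this
    exact EReal.coe_le_coe_iff.1 this
  have hmeas : AEStronglyMeasurable (fun θ => (u θ).toReal) μ :=
    aestronglyMeasurable_of_tendsto_ae _ (fun n => (hF n).1) hlim
  have hint2 : Integrable (fun θ => F 0 θ - (u θ).toReal) μ := by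
    refine ⟨(hF 0).1.sub hmeas, ?_⟩
    refine lt_of_le_of_lt ?_ (hsup.trans_lt ENNReal.ofReal_lt_top)
    apply lintegral_mono_ae
    filter_upwards [hlim, hler] with θ h1 h2
    rw [← ofReal_norm, Real.norm_of_nonneg (sub_nonneg.2 (h2 0))]
    have : Tendsto (fun n => ENNReal.ofReal (F 0 θ - F n θ)) atTop
        (𝓝 (ENNReal.ofReal (F 0 θ - (u θ).toReal))) :=
      ENNReal.tendsto_ofReal (tendsto_const_nhds.sub h1)
    exact le_of_tendsto this (Eventually.of_forall fun n =>
      le_iSup (fun n => ENNReal.ofReal (F 0 θ - F n θ)) n)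
  have hintg : Integrable (fun θ => (u θ).toReal) μ := by
    have := (hF 0).sub hint2
    refine this.congr (ae_of_all _ fun θ => ?_)
    simp
  refine ⟨hbot, hintg, ?_⟩
  have := tendsto_integral_of_dominated_convergence (fun θ => |F 0 θ| + |(u θ).toReal|)
    (fun n => (hF n).1) ((hF 0).abs.add hintg.abs) (fun n => by
      filter_upwards [hler] with θ h2
      have h3 := ha θ (Nat.zero_le n)
      simp only at h3
      rw [Real.norm_eq_abs, abs_le]
      have := h2 n
      have := neg_abs_le (u θ).toReal
      have := le_abs_self (F 0 θ)
      have := abs_nonneg (F 0 θ)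
      have := abs_nonneg (u θ).toReal
      constructor <;> linarith) hlim
  exact ge_of_tendsto this (Eventually.of_forall hx)

section
variable {E : Type*} [NormedAddCommGroup E] [NormedSpace ℂ E]

/-- Limit of partial sums as an extended real number. -/
noncomputable def limU (v : ℕ → E → ℝ) (p : E) : EReal :=
  limsup (fun n => ((∑ k ∈ Finset.range n, v k p : ℝ) : EReal)) atTop

lemma limU_spec {v : ℕ → E → ℝ} {p : E} {m : ℕ} (h : ∀ k, m ≤ k → v k p ≤ 0) :
    (Antitone fun n => ∑ k ∈ Finset.range (m + n), v k p) ∧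
    Tendsto (fun n => ((∑ k ∈ Finset.range (m + n), v k p : ℝ) : EReal)) atTop (𝓝 (limU v p)) := by
  have ha : Antitone fun n => ∑ k ∈ Finset.range (m + n), v k p := by
    apply antitone_nat_of_succ_le
    intro n
    rw [← add_assoc, Finset.sum_range_succ]
    linarith [h (m + n) (by omega)]
  refine ⟨ha, ?_⟩
  have ha' : Antitone fun n => ((∑ k ∈ Finset.range (m + n), v k p : ℝ) : EReal) :=
    fun i j hij => EReal.coe_le_coe_iff.2 (ha hij)
  have h1 := tendsto_atTop_iInf ha'
  have h2 : Tendsto (fun n => ((∑ k ∈ Finset.range n, v k p : ℝ) : EReal)) atTop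
      (𝓝 (⨅ n, ((∑ k ∈ Finset.range (m + n), v k p : ℝ) : EReal))) := by
    rw [← tendsto_add_atTop_iff_nat m]
    simpa [add_comm] using h1
  rw [limU, h2.limsup_eq]
  exact h1

lemma limU_le {v : ℕ → E → ℝ} {p : E} {m : ℕ} (h : ∀ k, m ≤ k → v k p ≤ 0) (n : ℕ) :
    limU v p ≤ ((∑ k ∈ Finset.range (m + n), v k p : ℝ) : EReal) :=
  le_of_tendsto (limU_spec h).2 (eventually_atTop.2 ⟨n, fun _ hk =>
    EReal.coe_le_coe_iff.2 ((limU_spec h).1 hk)⟩)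

lemma limU_bot {v : ℕ → E → ℝ} {p : E} {m : ℕ} (h : ∀ k, m ≤ k → v k p ≤ -1) :
    limU v p = ⊥ := by
  rw [EReal.eq_bot_iff_forall_lt]
  intro y
  obtain ⟨n, hn⟩ := exists_nat_gt (∑ k ∈ Finset.range m, v k p - y)
  refine (limU_le (fun k hk => (h k hk).trans (by norm_num)) n).trans_lt ?_
  rw [EReal.coe_lt_coe_iff, Finset.sum_range_add]
  have : ∑ x ∈ Finset.range n, v (m + x) p ≤ ∑ x ∈ Finset.range n, (-1 : ℝ) :=
    Finset.sum_le_sum fun i _ => h _ (by omega)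
  simp at this
  linarith

theorem psh_of_seq {Ω : Set E} (hΩ : IsPreconnected Ω) {v : ℕ → E → ℝ} {ρ : E → ℝ}
    (hv : ∀ k, ∀ p ∈ Ω, LSM (v k) p) (hρ : ContinuousOn ρ Ω)
    (h0 : ∀ k : ℕ, ∀ p ∈ Ω, ρ p ≤ k → v k p ≤ 0) {p0 : E} (hp0 : p0 ∈ Ω) {C : ℝ}
    (hC : ∀ n, C ≤ ∑ k ∈ Finset.range n, v k p0) :
    PSHOn (limU v) Ω ∧ limU v p0 ≠ ⊥ := by
  have hS : ∀ n, ∀ p ∈ Ω, LSM (fun q => ∑ k ∈ Finset.range n, v k q) p := fun n p hp =>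
    LSM.sum _ fun k _ => hv k p hp
  have hneg : ∀ m : ℕ, ∀ p ∈ Ω, ρ p ≤ m → ∀ k, m ≤ k → v k p ≤ 0 := fun m p hp hm k hk =>
    h0 k p hp (hm.trans (by exact_mod_cast hk))
  have hp0b : limU v p0 ≠ ⊥ := by
    obtain ⟨m, hm⟩ := exists_nat_ge (ρ p0)
    have h1 := (limU_spec (hneg m p0 hp0 hm)).2
    have h2 : (C : EReal) ≤ limU v p0 := ge_of_tendsto h1 (Eventually.of_forall fun n =>
      EReal.coe_le_coe_iff.2 (hC _))
    intro hb
    rw [hb] at h2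
    exact absurd h2 (not_le.2 (EReal.bot_lt_coe C))
  refine ⟨⟨fun p hp => ?_, fun p hp => ?_, fun p hp => ?_, ?_⟩, hp0b⟩
  · obtain ⟨m, hm⟩ := exists_nat_ge (ρ p)
    exact ((limU_le (hneg m p hp hm) 0).trans_lt (EReal.coe_lt_top _)).ne
  · intro y hy
    obtain ⟨m, hm⟩ := exists_nat_gt (ρ p)
    have h1 := limU_spec (hneg m p hp hm.le)
    obtain ⟨n, hn⟩ := (h1.2.eventually_lt_const hy).exists
    have hc : ContinuousAt (fun q => ((∑ k ∈ Finset.range (m + n), v k q : ℝ) : EReal)) p :=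
      continuous_coe_real_ereal.continuousAt.comp (hS (m + n) p hp).1.self_of_nhds
    filter_upwards [(hc.eventually_lt_const hn).filter_mono nhdsWithin_le_nhds,
      (hρ p hp).eventually_lt_const hm, self_mem_nhdsWithin] with q h2 h3 h4
    exact (limU_le (hneg m q h4 h3.le) n).trans_lt h2
  · exact ⟨p0, by rw [hΩ.connectedComponentIn hp]; exact hp0, hp0b⟩
  · intro a b c r hr hmem
    by_cases hbot : limU v (a + c • b) = ⊥
    · rw [hbot]; exact bot_le
    have hlc : Continuous (fun l : ℂ => a + l • b) := by fun_prop
    obtain ⟨m, hm⟩ : ∃ m : ℕ, ∀ l ∈ closedBall c r, ρ (a + l • b) ≤ m := by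
      have hcont : ContinuousOn (fun l : ℂ => ρ (a + l • b)) (closedBall c r) :=
        hρ.comp hlc.continuousOn hmem
      obtain ⟨M, hM⟩ := (isCompact_closedBall c r).bddAbove_image hcont
      obtain ⟨m, hm⟩ := exists_nat_ge M
      exact ⟨m, fun l hl => (hM ⟨l, hl, rfl⟩).trans hm⟩
    have hcm : ∀ θ, circleMap c r θ ∈ closedBall c r := fun θ => circleMap_mem_closedBall c hr.le θ
    have hcc : c ∈ closedBall c r := mem_closedBall_self hr.le
    let F : ℕ → ℝ → ℝ := fun n θ => ∑ k ∈ Finset.range (m + n), v k (a + circleMap c r θ • b)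
    have hFc : ∀ n, Continuous (F n) := by
      intro n
      rw [continuous_iff_continuousAt]
      intro θ
      exact ContinuousAt.comp (f := fun θ => a + circleMap c r θ • b)
        (hS (m + n) _ (hmem _ (hcm θ))).1.self_of_nhds
        (hlc.comp (continuous_circleMap c r)).continuousAt
    have htop : limU v (a + c • b) ≠ ⊤ :=
      ((limU_le (hneg m _ (hmem c hcc) (hm c hcc)) 0).trans_lt (EReal.coe_lt_top _)).ne
    set x := (limU v (a + c • b)).toReal with hxdef
    have hxe : limU v (a + c • b) = x := (EReal.coe_toReal htop hbot).symm
    have hx : ∀ n, 2 * Real.pi * x ≤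
        ∫ θ, F n θ ∂(volume.restrict (Set.Ioc (0:ℝ) (2 * Real.pi))) := by
      intro n
      have h1 := limU_le (hneg m _ (hmem c hcc) (hm c hcc)) n
      rw [hxe, EReal.coe_le_coe_iff] at h1
      have h2 := submean_global (v := fun l => ∑ k ∈ Finset.range (m + n), v k (a + l • b)) hr
        (fun l hl => (hS (m + n) _ (hmem l hl)).line)
      rw [Real.circleAverage, smul_eq_mul, intervalIntegral.integral_of_le Real.two_pi_pos.le] at h2
      have h3 := h1.trans h2
      rw [inv_mul_eq_div, le_div_iff₀ Real.two_pi_pos] at h3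
      rw [mul_comm]
      exact h3
    obtain ⟨r1, r2, r3⟩ := mono_conv (μ := volume.restrict (Set.Ioc (0:ℝ) (2 * Real.pi)))
      (F := F) (u := fun θ => limU v (a + circleMap c r θ • b)) (fun n => (hFc n).measurable)
      (fun n => ((hFc n).intervalIntegrable 0 (2 * Real.pi)).1)
      (fun θ => (limU_spec (hneg m _ (hmem _ (hcm θ)) (hm _ (hcm θ)))).1)
      (fun θ => (limU_spec (hneg m _ (hmem _ (hcm θ)) (hm _ (hcm θ)))).2) hx
    rw [circleAvg, if_pos, hxe, EReal.coe_le_coe_iff, le_div_iff₀ Real.two_pi_pos,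
      intervalIntegral.integral_of_le Real.two_pi_pos.le]
    · rw [mul_comm]; exact r3
    · exact ⟨(intervalIntegrable_iff_integrableOn_Ioc_of_le Real.two_pi_pos.le).2 r2, r1⟩

end
end PH
end

section
open Set Metric MeasureTheory Filter Topology
namespace PH

lemma no_local_max {u : ℂ → EReal} (hu : SubharmonicOn u univ) {ψ : ℂ → ℝ} {z : ℂ}
    (hψ : LSM ψ z) {x : ℝ} (hx : u z = x)
    (hmax : ∀ᶠ q in 𝓝 z, u q ≤ ((x + ψ z + ‖z‖ ^ 2 - (ψ q + ‖q‖ ^ 2) : ℝ) : EReal)) : False := by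
  obtain ⟨r, h1, h2, h3⟩ := ((hψ.2 1).and ((line_cont hψ.1 1).and (line_ev hmax 1))).exists
  simp only [smul_eq_mul, mul_one] at h1 h2 h3
  obtain ⟨hr, h3⟩ := h3
  have hs := hu.2.2.2 0 1 z r hr (fun l _ => mem_univ _)
  simp only [zero_add, smul_eq_mul, mul_one] at hs
  rw [hx, circleAvg] at hs
  split_ifs at hs with hc
  swap
  · exact absurd hs (not_le.2 (EReal.bot_lt_coe x))
  rw [EReal.coe_le_coe_iff, le_div_iff₀ Real.two_pi_pos] at hs
  have hi3 : CircleIntegrable (fun l : ℂ => ‖z + l‖ ^ 2) 0 r := by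
    apply ContinuousOn.circleIntegrable'; fun_prop
  have hi4 : CircleIntegrable (fun l : ℂ => ψ (z + l) + ‖z + l‖ ^ 2) 0 r := h2.add hi3
  have hav : ψ z + ‖z‖ ^ 2 + r ^ 2 ≤ Real.circleAverage (fun l => ψ (z + l) + ‖z + l‖ ^ 2) 0 r := by
    rw [Real.circleAverage_fun_add h2 hi3, avg_sq]
    linarith
  have hi5 : CircleIntegrable (fun l : ℂ => x + ψ z + ‖z‖ ^ 2 - (ψ (z + l) + ‖z + l‖ ^ 2)) 0 r :=
    (circleIntegrable_const _ _ _).sub hi4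
  have hav2 : Real.circleAverage (fun l : ℂ => x + ψ z + ‖z‖ ^ 2 - (ψ (z + l) + ‖z + l‖ ^ 2)) 0 r
      = x + ψ z + ‖z‖ ^ 2 - Real.circleAverage (fun l => ψ (z + l) + ‖z + l‖ ^ 2) 0 r := by
    rw [Real.circleAverage_fun_sub (circleIntegrable_const _ _ _) hi4, Real.circleAverage_const]
  have hle : ∫ θ in (0:ℝ)..(2 * Real.pi), (u (circleMap z r θ)).toReal ≤
      ∫ θ in (0:ℝ)..(2 * Real.pi), (x + ψ z + ‖z‖ ^ 2 - (ψ (z + circleMap 0 r θ) +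
        ‖z + circleMap 0 r θ‖ ^ 2)) := by
    apply intervalIntegral.integral_mono_ae_restrict Real.two_pi_pos.le hc.1 hi5
    rw [← restrict_Ioc_eq_restrict_Icc]
    filter_upwards [hc.2] with θ hθ
    have e : circleMap z r θ = z + circleMap 0 r θ := by simp [circleMap]
    rw [e] at hθ ⊢
    have h4 := h3 (circleMap 0 r θ) (circleMap_mem_closedBall 0 hr.le θ)
    have h5 := EReal.toReal_le_toReal h4 hθ (EReal.coe_ne_top _)
    rwa [EReal.toReal_coe] at h5
  have hav3 := hav2
  rw [Real.circleAverage, smul_eq_mul, inv_mul_eq_div, div_eq_iff Real.two_pi_pos.ne'] at hav3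
  rw [hav3] at hle
  have := hs.trans hle
  have h6 := le_of_mul_le_mul_right this Real.two_pi_pos
  have : 0 < r ^ 2 := by positivity
  linarith

lemma sub_max {u : ℂ → EReal} (hu : SubharmonicOn u univ) {ψ : ℂ → ℝ} (hψ : Continuous ψ)
    {R m : ℝ} (hR : 0 < R)
    (hcase : ∀ z ∈ closedBall (0:ℂ) R, u z ≤ ((m - ψ z : ℝ) : EReal) ∨
      (z ∈ ball (0:ℂ) R ∧ LSM ψ z)) :
    ∀ z ∈ closedBall (0:ℂ) R, u z ≤ ((m + R ^ 2 - ψ z : ℝ) : EReal) := by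
  intro z1 hz1
  have husc : UpperSemicontinuousOn (fun z => u z + ((ψ z + ‖z‖ ^ 2 : ℝ) : EReal))
      (closedBall (0:ℂ) R) := by
    apply UpperSemicontinuousOn.add'
    · exact hu.2.1.mono (subset_univ _)
    · apply ContinuousOn.upperSemicontinuousOn
      exact (continuous_coe_real_ereal.comp (by fun_prop)).continuousOn
    · intro x _
      exact EReal.continuousAt_add (Or.inr (EReal.coe_ne_bot _)) (Or.inr (EReal.coe_ne_top _))
  obtain ⟨z, hz, hmax⟩ := husc.exists_isMaxOn ⟨0, by simp [hR.le]⟩ (isCompact_closedBall _ _)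
  by_cases hb : u z = ⊥
  · have h := hmax hz1
    simp only [mem_ofPred_eq, hb, EReal.bot_add, le_bot_iff, EReal.add_eq_bot_iff] at h
    rcases h with h | h
    · rw [h]; exact bot_le
    · exact absurd h (EReal.coe_ne_bot _)
  set x := (u z).toReal
  have hx : u z = x := (EReal.coe_toReal (hu.1 z (mem_univ _)) hb).symm
  have key : ∀ q ∈ closedBall (0:ℂ) R,
      u q ≤ ((x + ψ z + ‖z‖ ^ 2 - (ψ q + ‖q‖ ^ 2) : ℝ) : EReal) := by
    intro q hq
    have h : u q + ((ψ q + ‖q‖ ^ 2 : ℝ) : EReal) ≤ u z + ((ψ z + ‖z‖ ^ 2 : ℝ) : EReal) := hmax hq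
    by_cases hqb : u q = ⊥
    · rw [hqb]; exact bot_le
    have hy : u q = (u q).toReal := (EReal.coe_toReal (hu.1 q (mem_univ _)) hqb).symm
    rw [hx, hy] at h
    rw [hy]
    rw [← EReal.coe_add, ← EReal.coe_add, EReal.coe_le_coe_iff] at h
    rw [EReal.coe_le_coe_iff]
    linarith
  have hzR : ‖z‖ ^ 2 ≤ R ^ 2 := by
    have : ‖z‖ ≤ R := by simpa using hz
    gcongr
  rcases hcase z hz with h | ⟨h1, h2⟩
  · refine (key z1 hz1).trans ?_
    rw [hx, EReal.coe_le_coe_iff] at h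
    rw [EReal.coe_le_coe_iff]
    have := sq_nonneg ‖z1‖
    linarith
  · exfalso
    apply no_local_max hu h2 hx
    filter_upwards [isOpen_ball.mem_nhds h1] with q hq
    exact key q (ball_subset_closedBall hq)

/-- truncated logarithmic kernel -/
noncomputable def lk (τ : ℝ) (z w : ℂ) : ℝ := Real.log (max ‖z - w‖ τ)

lemma lk_comm (τ : ℝ) (z w : ℂ) : lk τ z w = lk τ w z := by
  rw [lk, lk, norm_sub_rev]

lemma lk_self {τ : ℝ} (hτ : 0 < τ) (z : ℂ) : lk τ z z = Real.log τ := by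
  simp [lk, hτ.le]

lemma lk_cont {τ : ℝ} (hτ : 0 < τ) {X : Type*} [TopologicalSpace X] {f g : X → ℂ}
    (hf : Continuous f) (hg : Continuous g) : Continuous fun x => lk τ (f x) (g x) := by
  unfold lk
  apply Continuous.log (by fun_prop)
  intro x
  exact (lt_of_lt_of_le hτ (le_max_right _ _)).ne'

lemma fekete {K : Set ℂ} (hK : IsCompact K) (hne : K.Nonempty) {τ : ℝ} (hτ : 0 < τ) (n : ℕ) :
    ∃ a : Fin (n + 1) → ℂ, (∀ i, a i ∈ K) ∧ ∀ i, ∀ w ∈ K,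
      ∑ j, lk τ w (a (i.succAbove j)) ≤ ∑ j, lk τ (a i) (a (i.succAbove j)) := by
  have hcomp : IsCompact (Set.pi univ fun _ : Fin (n + 1) => K) := isCompact_univ_pi fun _ => hK
  obtain ⟨x0, hx0⟩ := hne
  have hc : Continuous fun a : Fin (n + 1) → ℂ => ∑ i, ∑ j, lk τ (a i) (a j) := by
    refine continuous_finsetSum _ fun i _ => continuous_finsetSum _ fun j _ => ?_
    exact lk_cont hτ (continuous_apply i) (continuous_apply j)
  obtain ⟨a, ha, hmax⟩ := hcomp.exists_isMaxOn ⟨fun _ => x0, fun _ _ => hx0⟩ hc.continuousOn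
  refine ⟨a, fun i => ha i (mem_univ _), fun i w hw => ?_⟩
  have hexp : ∀ b : Fin (n + 1) → ℂ, ∑ k, ∑ j, lk τ (b k) (b j) =
      Real.log τ + 2 * ∑ j, lk τ (b i) (b (i.succAbove j)) +
        ∑ k, ∑ j, lk τ (b (i.succAbove k)) (b (i.succAbove j)) := by
    intro b
    rw [Fin.sum_univ_succAbove _ i, Fin.sum_univ_succAbove _ i, lk_self hτ]
    have : ∀ k, ∑ j, lk τ (b (i.succAbove k)) (b j) = lk τ (b i) (b (i.succAbove k)) +
        ∑ j, lk τ (b (i.succAbove k)) (b (i.succAbove j)) := by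
      intro k
      rw [Fin.sum_univ_succAbove _ i, lk_comm]
    simp only [this, Finset.sum_add_distrib]
    ring
  have hmem : Function.update a i w ∈ Set.pi univ fun _ : Fin (n + 1) => K := by
    intro j _
    by_cases hj : j = i
    · subst hj; simpa using hw
    · simpa [hj] using ha j (mem_univ _)
  have h := hmax hmem
  simp only [mem_ofPred_eq] at h
  rw [hexp, hexp] at h
  simp only [Function.update_self, ne_eq, Fin.succAbove_ne, not_false_eq_true,
    Function.update_of_ne] at h
  linarith

lemma lk_lower {τ : ℝ} (hτ : 0 < τ) {N : ℕ} (a : Fin (N + 1) → ℂ) {B : ℝ}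
    (hB : ∀ i, B ≤ ∑ j, lk τ (a i) (a j)) (z : ℂ) :
    B - (N + 1) * Real.log 2 ≤ ∑ j, lk τ z (a j) := by
  obtain ⟨i, -, hi⟩ := Finset.exists_min_image Finset.univ (fun i => ‖z - a i‖)
    ⟨0, Finset.mem_univ _⟩
  have h1 : ∀ j, lk τ (a i) (a j) - Real.log 2 ≤ lk τ z (a j) := by
    intro j
    have h2 := hi j (Finset.mem_univ _)
    have h3 : ‖a i - a j‖ ≤ 2 * ‖z - a j‖ := by
      have : a i - a j = (z - a j) - (z - a i) := by ring
      rw [this]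
      refine (norm_sub_le _ _).trans (by linarith)
    have h4 : max ‖a i - a j‖ τ ≤ 2 * max ‖z - a j‖ τ := by
      apply max_le
      · exact h3.trans (by gcongr; exact le_max_left _ _)
      · linarith [le_max_right ‖z - a j‖ τ]
    have h5 : 0 < max ‖z - a j‖ τ := lt_of_lt_of_le hτ (le_max_right _ _)
    have h6 := Real.log_le_log (lt_of_lt_of_le hτ (le_max_right _ _)) h4
    rw [Real.log_mul (by norm_num) h5.ne'] at h6
    unfold lk
    linarith
  have := Finset.sum_le_sum fun j (_ : j ∈ Finset.univ) => h1 j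
  simp only [Finset.sum_sub_distrib, Finset.sum_const, Finset.card_univ, Fintype.card_fin,
    nsmul_eq_mul, Nat.cast_add, Nat.cast_one] at this
  linarith [hB i]

theorem cheb {K : Set ℂ} (hK : IsCompact K) (hne : K.Nonempty) (hp : PolarSet K) (M : ℝ) :
    ∃ (n : ℕ) (a : Fin n → ℂ), 0 < n ∧ (∀ i, a i ∈ K) ∧
      ∀ z ∈ K, ∏ i, ‖z - a i‖ ≤ Real.exp (-(M * n)) := by
  wlog hM : 0 ≤ M generalizing M
  · obtain ⟨n, a, h1, h2, h3⟩ := this 0 le_rfl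
    refine ⟨n, a, h1, h2, fun z hz => (h3 z hz).trans ?_⟩
    apply Real.exp_le_exp.2
    push Not at hM
    have : M * n ≤ 0 := mul_nonpos_of_nonpos_of_nonneg hM.le (by positivity)
    linarith
  by_contra hcon
  push Not at hcon
  obtain ⟨u, hu, hub⟩ := hp
  obtain ⟨z1, -, hz1⟩ := hu.2.2.1 0 (mem_univ _)
  set x1 := (u z1).toReal
  have hx1 : u z1 = x1 := (EReal.coe_toReal (hu.1 z1 (mem_univ _)) hz1).symm
  obtain ⟨R, hR1, hRK, hRz⟩ : ∃ R : ℝ, 1 ≤ R ∧ (∀ z ∈ K, ‖z‖ ≤ R) ∧ ‖z1‖ ≤ R := by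
    obtain ⟨R, hR⟩ := hK.isBounded.exists_norm_le
    refine ⟨max (max R 1) ‖z1‖, by simp, fun z hz => (hR z hz).trans (by simp), by simp⟩
  obtain ⟨C0, hC0, hC⟩ : ∃ C0 : ℝ, 0 ≤ C0 ∧ ∀ z ∈ closedBall (0:ℂ) (4 * R), u z ≤ C0 := by
    obtain ⟨z, hz, hmax⟩ := (hu.2.1.mono (subset_univ (closedBall (0:ℂ) (4 * R)))).exists_isMaxOn
      ⟨0, by simp; linarith⟩ (isCompact_closedBall _ _)
    refine ⟨max (u z).toReal 0, by simp, fun q hq => ?_⟩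
    refine (hmax hq).trans ?_
    refine (EReal.le_coe_toReal (hu.1 z (mem_univ _))).trans ?_
    exact EReal.coe_le_coe_iff.2 (le_max_left _ _)
  set M2 := M + 2 + Real.log (3 * R) with hM2
  have hlog3 : 0 < Real.log (3 * R) := Real.log_pos (by linarith)
  have hM2pos : 0 < M2 := by linarith
  have key : ∀ T : ℝ, 0 < T → x1 + T * Real.log (3 / 2) / M2 ≤ C0 + (4 * R) ^ 2 := by
    intro T hT
    have hopen : IsOpen {z | u z < ((-T : ℝ) : EReal)} := by
      have : UpperSemicontinuous u := upperSemicontinuousOn_univ_iff.1 hu.2.1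
      exact this.isOpen_preimage _
    obtain ⟨τ0, hτ0, hτsub⟩ := hK.exists_cthickening_subset_open hopen
      (fun z hz => by rw [mem_ofPred_eq, hub z hz]; exact EReal.bot_lt_coe _)
    obtain ⟨τ, hτ, hττ0, hτ1⟩ : ∃ τ > 0, τ ≤ τ0 ∧ τ ≤ 1 :=
      ⟨min τ0 1, by positivity, min_le_left _ _, min_le_right _ _⟩
    obtain ⟨n, hn⟩ := exists_nat_ge (max 1 (-Real.log τ))
    have hn1 : (1:ℝ) ≤ n := (le_max_left _ _).trans hn
    have hn2 : -Real.log τ ≤ n := (le_max_right _ _).trans hn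
    obtain ⟨a, haK, hmax⟩ := fekete hK hne hτ n
    have hP1 : ∀ i, -(M * n) + Real.log τ ≤ ∑ j, lk τ (a i) (a j) := by
      intro i
      rw [Fin.sum_univ_succAbove _ i, lk_self hτ]
      obtain ⟨z, hz, hlt⟩ := hcon n (fun j => a (i.succAbove j))
        (by have : 0 < (n:ℝ) := by linarith
            exact_mod_cast this) (fun j => haK _)
      have h1 : ∏ j, ‖z - a (i.succAbove j)‖ ≤ Real.exp (∑ j, lk τ z (a (i.succAbove j))) := by
        rw [Real.exp_sum]
        apply Finset.prod_le_prod (fun _ _ => norm_nonneg _)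
        intro j _
        rw [lk, Real.exp_log (lt_of_lt_of_le hτ (le_max_right _ _))]
        exact le_max_left _ _
      have h2 := Real.exp_lt_exp.1 (hlt.trans_le h1)
      linarith [hmax i z hz]
    have hP : ∀ z, -((M + 2) * (n + 1)) ≤ ∑ j, lk τ z (a j) := by
      intro z
      have := lk_lower hτ a hP1 z
      have hl2 : Real.log 2 ≤ 1 := by linarith [Real.log_two_lt_d9]
      nlinarith
    set ψ : ℂ → ℝ := fun z => T / ((n + 1) * M2) * ((n + 1) * Real.log (3 * R) - ∑ j, lk τ z (a j))
      with hψ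
    have hcoef : 0 ≤ T / ((n + 1) * M2) := by positivity
    have hψc : Continuous ψ := by
      apply Continuous.mul continuous_const
      apply continuous_const.sub
      exact continuous_finsetSum _ fun j _ => lk_cont hτ continuous_id continuous_const
    have hψT : ∀ z, ψ z ≤ T := by
      intro z
      have h1 : (n + 1) * Real.log (3 * R) - ∑ j, lk τ z (a j) ≤ (n + 1) * M2 := by
        have := hP z
        rw [hM2]; linarith
      calc ψ z ≤ T / ((n + 1) * M2) * ((n + 1) * M2) := by
            exact mul_le_mul_of_nonneg_left h1 hcoef
        _ = T := by field_simp
    have hmain := sub_max hu hψc (R := 4 * R) (m := C0) (by linarith) ?_ z1 (by simp; linarith)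
    · rw [hx1, EReal.coe_le_coe_iff] at hmain
      have h1 : T * Real.log (3 / 2) / M2 ≤ ψ z1 := by
        have h2 : ∑ j, lk τ z1 (a j) ≤ (n + 1) * Real.log (2 * R) := by
          have : ∀ j ∈ (Finset.univ : Finset (Fin (n + 1))), lk τ z1 (a j) ≤ Real.log (2 * R) := by
            intro j _
            apply Real.log_le_log (lt_of_lt_of_le hτ (le_max_right _ _))
            apply max_le
            · refine (norm_sub_le _ _).trans ?_
              linarith [hRK _ (haK j)]
            · linarith
          have := Finset.sum_le_sum this
          simpa using this
        have h3 : Real.log (3 / 2) = Real.log (3 * R) - Real.log (2 * R) := by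
          rw [← Real.log_div (by positivity) (by positivity)]
          congr 1; field_simp
        calc T * Real.log (3 / 2) / M2 = T / ((n + 1) * M2) * ((n + 1) * Real.log (3 / 2)) := by
              field_simp
          _ ≤ _ := by
            apply mul_le_mul_of_nonneg_left _ hcoef
            rw [h3]; linarith
      linarith
    · intro z hz
      by_cases hzj : ∃ j, ‖z - a j‖ ≤ τ
      · left
        obtain ⟨j, hj⟩ := hzj
        have : z ∈ cthickening τ0 K :=
          mem_cthickening_of_dist_le z (a j) τ0 K (haK j) (by rw [dist_eq_norm]; linarith)
        refine (hτsub this).le.trans ?_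
        rw [EReal.coe_le_coe_iff]
        linarith [hψT z]
      push Not at hzj
      by_cases hzb : z ∈ ball (0:ℂ) (4 * R)
      · right
        refine ⟨hzb, ?_⟩
        have hL : LSM (fun z => T / ((n + 1) * M2) * (∑ j, (Real.log (3 * R) +
            -Real.log ‖z - a j‖))) z := by
          apply LSM.const_mul _ hcoef
          apply LSM.sum
          intro j _
          apply (LSM.const _ _).add
          apply LSM.neg_log_norm (h := fun z => z - a j)
          · exact Eventually.of_forall fun q => by fun_prop
          · intro h0
            have := hzj j
            rw [h0, norm_zero] at this; linarith
        apply hL.congr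
        have : ∀ᶠ q in 𝓝 z, ∀ j, τ < ‖q - a j‖ := by
          rw [eventually_all]
          intro j
          have : ContinuousAt (fun q : ℂ => ‖q - a j‖) z := by fun_prop
          exact this.eventually_const_lt (hzj j)
        filter_upwards [this] with q hq
        simp only [hψ, Finset.sum_add_distrib, Finset.sum_neg_distrib, Finset.sum_const,
          Finset.card_univ, Fintype.card_fin, nsmul_eq_mul]
        congr 1
        have : ∀ j, lk τ q (a j) = Real.log ‖q - a j‖ := fun j => by
          rw [lk, max_eq_left (hq j).le]
        simp only [this]
        push_cast; ring
      · left
        refine (hC z hz).trans ?_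
        rw [EReal.coe_le_coe_iff]
        have : ψ z ≤ 0 := by
          apply mul_nonpos_of_nonneg_of_nonpos hcoef
          have : ∀ j ∈ (Finset.univ : Finset (Fin (n + 1))), Real.log (3 * R) ≤ lk τ z (a j) := by
            intro j _
            apply Real.log_le_log (by linarith)
            refine le_trans ?_ (le_max_left _ _)
            have h1 : 4 * R ≤ ‖z‖ := by simpa using hzb
            have h2 := norm_sub_norm_le z (a j)
            linarith [hRK _ (haK j)]
          have := Finset.sum_le_sum this
          simp at this
          linarith
        linarith
  have hl : 0 < Real.log (3 / 2) := Real.log_pos (by norm_num)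
  set W := |C0 + (4 * R) ^ 2 - x1| + 1 with hW
  have hWpos : 0 < W := by positivity
  have := key (W * M2 / Real.log (3 / 2)) (by positivity)
  have e : W * M2 / Real.log (3 / 2) * Real.log (3 / 2) / M2 = W := by field_simp
  rw [e] at this
  have := le_abs_self (C0 + (4 * R) ^ 2 - x1)
  linarith

end PH
end

section
open Set Metric MeasureTheory Filter Topology
namespace PH

lemma polar_mono {P Q : Set ℂ} (h : PolarSet Q) (hs : P ⊆ Q) : PolarSet P := by
  obtain ⟨u, hu, hub⟩ := h
  exact ⟨u, hu, fun z hz => hub z (hs hz)⟩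

lemma radii {K : Set ℂ} (hK : IsCompact K) (hp : PolarSet K) (c : ℂ) {α β : ℝ} (hα : 0 < α)
    (hαβ : α < β) : ∃ r ∈ Ioo α β, ∀ z ∈ K, ‖z - c‖ ≠ r := by
  by_contra hcon
  push Not at hcon
  have hne : K.Nonempty := by
    obtain ⟨z, hz, -⟩ := hcon ((α + β) / 2) ⟨by linarith, by linarith⟩
    exact ⟨z, hz⟩
  obtain ⟨B0, hB0⟩ := hK.isBounded.exists_norm_le
  set B := |B0| + ‖c‖ + β with hB
  have hβ : 0 < β := hα.trans hαβ
  have hBpos : 0 < B := by positivity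
  set J := ∫ t in (-B)..B, |Real.log t| with hJ
  have hJ0 : 0 ≤ J := intervalIntegral.integral_nonneg (by linarith) fun _ _ => abs_nonneg _
  set M := (J + 1) / (β - α) with hM
  obtain ⟨n, a, hn, haK, hle⟩ := cheb hK hne hp M
  have hlogint : ∀ x y : ℝ, IntervalIntegrable Real.log volume x y := fun x y =>
    intervalIntegral.intervalIntegrable_log'
  have hsh : ∀ t : ℝ, IntervalIntegrable (fun x => Real.log (x - t)) volume α β := by
    intro t
    have := (hlogint (α - t) (β - t)).comp_sub_right t
    simpa using this
  have h1 : ∀ i, -J ≤ ∫ x in α..β, Real.log (x - ‖a i - c‖) := by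
    intro i
    rw [intervalIntegral.integral_comp_sub_right (fun x => Real.log x)]
    have hx : ‖a i - c‖ ≤ |B0| + ‖c‖ := (norm_sub_le _ _).trans
      (by linarith [hB0 _ (haK i), le_abs_self B0])
    have hx0 := norm_nonneg (a i - c)
    have h2 := intervalIntegral.abs_integral_le_integral_abs (μ := volume) (f := Real.log)
      (show α - ‖a i - c‖ ≤ β - ‖a i - c‖ by linarith)
    have h3 : ∫ x in (α - ‖a i - c‖)..(β - ‖a i - c‖), |Real.log x| ≤ J := by
      apply intervalIntegral.integral_mono_interval (by linarith) (by linarith) (by linarith)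
      · exact ae_of_all _ fun x => abs_nonneg _
      · exact (hlogint _ _).abs
    have := neg_abs_le (∫ x in (α - ‖a i - c‖)..(β - ‖a i - c‖), Real.log x)
    linarith
  have h2 : ∫ x in α..β, ∑ i, Real.log (x - ‖a i - c‖) ≤ ∫ x in α..β, (-(M * n)) := by
    apply intervalIntegral.integral_mono_ae_restrict hαβ.le
    · exact (IntervalIntegrable.sum Finset.univ fun i _ => hsh ‖a i - c‖).congr (by
        intro x _; simp)
    · exact intervalIntegrable_const
    · have hfin : ∀ᵐ x ∂(volume : Measure ℝ), ∀ i, x ≠ ‖a i - c‖ := by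
        rw [ae_all_iff]
        intro i
        exact Measure.ae_ne volume _
      have hfin2 : ∀ᵐ x ∂(volume.restrict (Icc α β)), x ∈ Ioo α β := by
        rw [← restrict_Ioo_eq_restrict_Icc]
        exact ae_restrict_mem measurableSet_Ioo
      filter_upwards [ae_restrict_of_ae hfin, hfin2] with x hx hx2
      obtain ⟨z, hz, hzx⟩ := hcon x hx2
      have h3 := hle z hz
      have h4 : ∏ i, |x - ‖a i - c‖| ≤ ∏ i, ‖z - a i‖ := by
        apply Finset.prod_le_prod (fun _ _ => abs_nonneg _)
        intro i _
        rw [← hzx]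
        have := abs_norm_sub_norm_le (z - c) (a i - c)
        simpa using this
      have h5 : 0 < ∏ i, |x - ‖a i - c‖| :=
        Finset.prod_pos fun i _ => abs_pos.2 (sub_ne_zero.2 (hx i))
      have h6 := Real.log_le_log h5 (h4.trans h3)
      rw [Real.log_exp, Real.log_prod (fun i _ => (abs_pos.2 (sub_ne_zero.2 (hx i))).ne')] at h6
      simpa [Real.log_abs] using h6
  rw [intervalIntegral.integral_finsetSum (fun i _ => hsh _)] at h2
  have h3 := Finset.sum_le_sum fun i (_ : i ∈ Finset.univ) => h1 i
  simp at h3 h2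
  have h4 : (β - α) * (M * n) = (J + 1) * n := by
    have : β - α ≠ 0 := by linarith
    rw [hM]; field_simp
  have : (0:ℝ) < n := by exact_mod_cast hn
  nlinarith

lemma max_principle {K O : Set ℂ} (hK : IsCompact K) (hne : K.Nonempty) (hp : PolarSet K)
    (hO : IsOpen O) (hOb : Bornology.IsBounded O) (hOK : Disjoint O K) {F : ℂ → ℂ}
    (hF : DifferentiableOn ℂ F O) (hFc : ContinuousOn F (closure O \ K)) {C m : ℝ} (hm : 0 < m)
    (hC : ∀ z ∈ O, ‖F z‖ ≤ C) (hfr : ∀ z ∈ frontier O, z ∉ K → ‖F z‖ ≤ m) :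
    ∀ z ∈ O, ‖F z‖ ≤ m := by
  intro z0 hz0
  by_contra hlt
  push Not at hlt
  have hCm : m < C := hlt.trans_le (hC z0 hz0)
  have hCpos : 0 < C := hm.trans hCm
  obtain ⟨ρ, hρ1, hρ⟩ : ∃ ρ : ℝ, 1 ≤ ρ ∧ ∀ z ∈ closure O, ∀ w ∈ K, ‖z - w‖ ≤ ρ := by
    obtain ⟨b1, hb1⟩ := hOb.closure.exists_norm_le
    obtain ⟨b2, hb2⟩ := hK.isBounded.exists_norm_le
    refine ⟨max 1 (b1 + b2), le_max_left _ _, fun z hz w hw => ?_⟩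
    refine (norm_sub_le _ _).trans (le_trans ?_ (le_max_right _ _))
    linarith [hb1 z hz, hb2 w hw]
  have hz0K : z0 ∉ K := fun h => hOK.le_bot ⟨hz0, h⟩
  obtain ⟨δ0, hδ0, hδdK⟩ : ∃ δ0 > 0, ∀ w ∈ K, δ0 ≤ ‖z0 - w‖ := by
    refine ⟨infDist z0 K, (hK.isClosed.notMem_iff_infDist_pos hne).1 hz0K, fun w hw => ?_⟩
    rw [← dist_eq_norm]; exact infDist_le_dist_of_mem hw
  set η := Real.log (‖F z0‖ / m) with hη
  have hηpos : 0 < η := Real.log_pos ((one_lt_div hm).2 hlt)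
  obtain ⟨t, ht⟩ := exists_nat_gt (Real.log (ρ / δ0) / η)
  rw [div_lt_iff₀ hηpos] at ht
  set L := Real.log (C / m) with hL
  have hLpos : 0 < L := Real.log_pos ((one_lt_div hm).2 hCm)
  obtain ⟨n, a, hn, haK, hle⟩ := cheb hK hne hp (t * L + 1)
  have hnpos : (0:ℝ) < n := by exact_mod_cast hn
  let Q : ℂ → ℂ := fun z => ∏ i, (z - a i)
  have hQd : Differentiable ℂ Q := by
    intro z
    exact DifferentiableAt.fun_finsetProd fun i _ => by fun_prop
  have hQn : ∀ z, ‖Q z‖ = ∏ i, ‖z - a i‖ := fun z => norm_prod _ _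
  have hNopen : IsOpen {z | ‖Q z‖ < Real.exp (-(t * L * n))} :=
    isOpen_lt hQd.continuous.norm continuous_const
  obtain ⟨δ, hδ, hsub⟩ := hK.exists_cthickening_subset_open hNopen (fun z hz => by
    rw [mem_ofPred_eq, hQn]
    refine (hle z hz).trans_lt (Real.exp_lt_exp.2 ?_)
    nlinarith)
  let G : ℂ → ℂ := fun z => (F z / m) ^ (n * t) * (Q z / (ρ:ℂ) ^ n)
  have hGn : ∀ z, ‖G z‖ = (‖F z‖ / m) ^ (n * t) * (‖Q z‖ / ρ ^ n) := by
    intro z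
    simp only [G, norm_mul, norm_pow, norm_div, Complex.norm_real, Real.norm_eq_abs,
      abs_of_pos hm, abs_of_pos (lt_of_lt_of_le one_pos hρ1)]
  have hρn : 1 ≤ ρ ^ n := one_le_pow₀ hρ1
  -- estimate near `K`
  have hnear : ∀ z ∈ O, z ∈ cthickening δ K → ‖G z‖ ≤ 1 := by
    intro z hz hzc
    have h1 : ‖Q z‖ < Real.exp (-(t * L * n)) := hsub hzc
    have h2 : (‖F z‖ / m) ^ (n * t) ≤ Real.exp (t * L * n) := by
      have : (C / m) ^ (n * t) = Real.exp (t * L * n) := by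
        rw [← Real.exp_log (show 0 < C / m by positivity), ← Real.exp_nat_mul]
        congr 1; push_cast; ring
      rw [← this]
      gcongr
      exact hC z hz
    rw [hGn]
    have h3 : ‖Q z‖ / ρ ^ n ≤ Real.exp (-(t * L * n)) :=
      (div_le_self (norm_nonneg _) hρn).trans h1.le
    calc _ ≤ Real.exp (t * L * n) * Real.exp (-(t * L * n)) := by gcongr
      _ = 1 := by rw [← Real.exp_add]; simp
  have hG1 : ‖G z0‖ ≤ 1 := by
    by_cases hz0c : z0 ∈ cthickening δ K
    · exact hnear z0 hz0 hz0c
    set U := O \ cthickening δ K with hU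
    have hUo : IsOpen U := hO.sdiff isClosed_cthickening
    have hUcl : closure U ⊆ closure O \ K := by
      intro z hz
      refine ⟨closure_mono sdiff_subset hz, fun hzK => ?_⟩
      have : z ∈ thickening δ K := self_subset_thickening hδ K hzK
      obtain ⟨w, hw1, hw2⟩ := mem_closure_iff.1 hz _ isOpen_thickening this
      exact hw2.2 (thickening_subset_cthickening _ _ hw1)
    have hGd : DiffContOnCl ℂ G U := by
      constructor
      · have h1 : DifferentiableOn ℂ F U := hF.mono sdiff_subset
        have h2 := hQd.differentiableOn (s := U)
        exact ((h1.div_const _).pow _).mul (h2.div_const _)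
      · have h1 : ContinuousOn F (closure U) := hFc.mono hUcl
        have h2 := hQd.continuous.continuousOn (s := closure U)
        exact ((h1.div_const _).pow _).mul (h2.div_const _)
    refine Complex.norm_le_of_forall_mem_frontier_norm_le (hOb.subset sdiff_subset) hGd ?_
      (subset_closure ⟨hz0, hz0c⟩)
    intro z hz
    have hzcl := hUcl (frontier_subset_closure hz)
    by_cases hzO : z ∈ O
    · apply hnear z hzO
      by_contra hzc
      rw [hUo.frontier_eq] at hz
      exact hz.2 ⟨hzO, hzc⟩
    · have h1 := hfr z (by rw [hO.frontier_eq]; exact ⟨hzcl.1, hzO⟩) hzcl.2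
      have h2 : ‖Q z‖ ≤ ρ ^ n := by
        rw [hQn]
        have := Finset.prod_le_prod (s := Finset.univ) (f := fun i => ‖z - a i‖) (g := fun _ => ρ)
          (fun _ _ => norm_nonneg _) (fun i _ => hρ z hzcl.1 _ (haK i))
        simpa using this
      rw [hGn]
      apply mul_le_one₀
      · exact pow_le_one₀ (by positivity) ((div_le_one hm).2 h1)
      · positivity
      · exact (div_le_one (by positivity)).2 h2
  have h2 : δ0 ^ n ≤ ‖Q z0‖ := by
    rw [hQn]
    have := Finset.prod_le_prod (s := Finset.univ) (f := fun _ : Fin n => δ0)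
      (g := fun i => ‖z0 - a i‖)
      (fun _ _ => hδ0.le) (fun i _ => hδdK _ (haK i))
    simpa using this
  rw [hGn] at hG1
  have h3 : (‖F z0‖ / m) ^ (n * t) * (δ0 ^ n / ρ ^ n) ≤ 1 := by
    refine le_trans ?_ hG1
    gcongr
  have hFpos : 0 < ‖F z0‖ / m := by
    have := hm.trans hlt; positivity
  have h4 := Real.log_le_log (by positivity) h3
  rw [Real.log_one, Real.log_mul (by positivity) (by positivity), ← div_pow, Real.log_pow,
    Real.log_pow, ← hη] at h4
  have h5 : Real.log (δ0 / ρ) = - Real.log (ρ / δ0) := by rw [← Real.log_inv, inv_div]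
  rw [h5] at h4
  push_cast at h4
  have h6 : n * (t * η - Real.log (ρ / δ0)) ≤ 0 := by linarith
  have : 0 < n * (t * η - Real.log (ρ / δ0)) := mul_pos hnpos (by linarith)
  linarith

lemma inter_compact {D A X : Set ℂ} (hAclosed : ∀ z ∈ D, z ∈ closure A → z ∈ A)
    (hX : IsCompact X) (hXD : X ⊆ D) : IsCompact (A ∩ X) := by
  have : A ∩ X = closure A ∩ X := by
    ext z
    exact ⟨fun h => ⟨subset_closure h.1, h.2⟩, fun h => ⟨hAclosed z (hXD h.2) h.1, h.2⟩⟩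
  rw [this]
  exact hX.inter_left isClosed_closure

lemma good_ball {D A : Set ℂ} (hD : IsOpen D) (hAclosed : ∀ z ∈ D, z ∈ closure A → z ∈ A)
    (hp : PolarSet A) {c : ℂ} (hc : c ∈ D) {δ : ℝ} (hδ : 0 < δ) :
    ∃ r, 0 < r ∧ r < δ ∧ closedBall c r ⊆ D ∧ Disjoint (sphere c r) A := by
  obtain ⟨ε, hε, hεD⟩ := nhds_basis_closedBall.mem_iff.1 (hD.mem_nhds hc)
  have hK := inter_compact hAclosed (isCompact_closedBall c ε) hεD
  obtain ⟨r, hr, hr2⟩ := radii hK (polar_mono hp inter_subset_left) c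
    (α := min ε δ / 2) (β := min ε δ) (by positivity) (by have := lt_min hε hδ; linarith)
  have hmin := lt_min hε hδ
  have hr0 : 0 < r := by linarith [hr.1]
  have hrε : r ≤ ε := hr.2.le.trans (min_le_left _ _)
  refine ⟨r, hr0, hr.2.trans_le (min_le_right _ _), (closedBall_subset_closedBall hrε).trans hεD,
    ?_⟩
  rw [Set.disjoint_left]
  intro z hz hzA
  have h1 : ‖z - c‖ = r := mem_sphere_iff_norm.1 hz
  exact hr2 z ⟨hzA, by rw [mem_closedBall, dist_eq_norm, h1]; exact hrε⟩ h1

lemma good_cover {D A X : Set ℂ} (hD : IsOpen D) (hAD : A ⊆ D)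
    (hAclosed : ∀ z ∈ D, z ∈ closure A → z ∈ A)
    (hp : PolarSet A) (hX : IsCompact X) (hXD : X ⊆ D) :
    ∃ W : Set ℂ, IsOpen W ∧ A ∩ X ⊆ W ∧ W ⊆ D ∧ IsCompact (A ∩ W) ∧ Bornology.IsBounded W := by
  have hK := inter_compact hAclosed hX hXD
  have : ∀ z ∈ A ∩ X, ∃ r, 0 < r ∧ closedBall z r ⊆ D ∧ Disjoint (sphere z r) A := by
    intro z hz
    obtain ⟨r, h1, -, h2, h3⟩ := good_ball hD hAclosed hp (hAD hz.1) one_pos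
    exact ⟨r, h1, h2, h3⟩
  choose! r hr0 hrD hrA using this
  obtain ⟨t, htK, htc⟩ := hK.elim_nhds_subcover (fun z => ball z (r z))
    (fun z hz => ball_mem_nhds z (hr0 z hz))
  refine ⟨⋃ z ∈ t, ball z (r z), isOpen_biUnion fun _ _ => isOpen_ball, htc,
    iUnion₂_subset fun z hz => ball_subset_closedBall.trans (hrD z (htK z hz)), ?_, ?_⟩
  · rw [inter_iUnion₂]
    apply t.isCompact_biUnion
    intro z hz
    have : A ∩ ball z (r z) = A ∩ closedBall z (r z) := by
      ext w
      refine ⟨fun h => ⟨h.1, ball_subset_closedBall h.2⟩, fun h => ⟨h.1, ?_⟩⟩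
      have h1 : w ∉ sphere z (r z) := fun h' => (hrA z (htK z hz)).le_bot ⟨h', h.1⟩
      exact lt_of_le_of_ne (mem_closedBall.1 h.2) h1
    rw [this]
    exact inter_compact hAclosed (isCompact_closedBall _ _) (hrD z (htK z hz))
  · rw [Bornology.isBounded_biUnion_finset]
    exact fun z _ => isBounded_ball

end PH
end

section
open Set Metric MeasureTheory Filter Topology
namespace PH

/-- Cauchy transform over a circle. -/
noncomputable def cI (g : ℂ → ℂ) (c : ℂ) (R : ℝ) (z : ℂ) : ℂ :=
  (2 * Real.pi * Complex.I : ℂ)⁻¹ • ∮ ζ in C(c, R), (ζ - z)⁻¹ * g ζ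

lemma cI_diff {g : ℂ → ℂ} {c : ℂ} {R : ℝ} (hR : 0 < R) (hg : ContinuousOn g (sphere c R)) {z : ℂ}
    (hz : ‖z - c‖ ≠ R) : DifferentiableAt ℂ (cI g c R) z := by
  unfold cI
  refine DifferentiableAt.fun_const_smul ?_ _
  have hgc : Continuous (fun θ : ℝ => g (circleMap c R θ)) :=
    hg.comp_continuous (continuous_circleMap c R) (circleMap_mem_sphere c hR.le)
  obtain ⟨M, hM⟩ := (isCompact_sphere c R).exists_bound_of_continuousOn hg
  set δ := |‖z - c‖ - R| / 2 with hδ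
  have hδ0 : 0 < δ := by
    have : 0 < |‖z - c‖ - R| := abs_pos.2 (sub_ne_zero.2 hz)
    positivity
  have hd : ∀ x ∈ ball z δ, ∀ θ : ℝ, δ ≤ ‖circleMap c R θ - x‖ := by
    intro x hx θ
    have h1 : ‖circleMap c R θ - c‖ = R := by
      simpa using mem_sphere_iff_norm.1 (circleMap_mem_sphere c hR.le θ)
    have h2 : |‖z - c‖ - ‖circleMap c R θ - c‖| ≤ ‖(z - c) - (circleMap c R θ - c)‖ :=
      abs_norm_sub_norm_le _ _
    rw [h1, sub_sub_sub_cancel_right] at h2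
    have h3 : ‖x - z‖ < δ := by simpa [dist_eq_norm] using hx
    have h4 : ‖z - circleMap c R θ‖ ≤ ‖x - z‖ + ‖circleMap c R θ - x‖ := by
      rw [norm_sub_rev x z, norm_sub_rev (circleMap c R θ) x]
      simpa using norm_add_le (z - x) (x - circleMap c R θ)
    linarith
  have hne : ∀ x ∈ ball z δ, ∀ θ : ℝ, circleMap c R θ - x ≠ 0 := by
    intro x hx θ h
    have := hd x hx θ
    rw [h, norm_zero] at this
    linarith
  have hcont : ∀ x ∈ ball z δ, Continuous (fun θ : ℝ =>
      deriv (circleMap c R) θ • ((circleMap c R θ - x)⁻¹ * g (circleMap c R θ))) := by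
    intro x hx
    have h1 : Continuous (fun θ : ℝ => deriv (circleMap c R) θ) := by
      simp only [deriv_circleMap]
      fun_prop
    have h2 : Continuous fun θ : ℝ => (circleMap c R θ - x)⁻¹ :=
      ((continuous_circleMap c R).sub continuous_const).inv₀ (hne x hx)
    exact h1.smul (h2.mul hgc)
  have hcont' : ∀ x ∈ ball z δ, Continuous (fun θ : ℝ =>
      deriv (circleMap c R) θ • (((circleMap c R θ - x)^2)⁻¹ * g (circleMap c R θ))) := by
    intro x hx
    have h1 : Continuous (fun θ : ℝ => deriv (circleMap c R) θ) := by
      simp only [deriv_circleMap]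
      fun_prop
    have h2 : Continuous fun θ : ℝ => ((circleMap c R θ - x)^2)⁻¹ :=
      (((continuous_circleMap c R).sub continuous_const).pow 2).inv₀
        (fun θ => pow_ne_zero 2 (hne x hx θ))
    exact h1.smul (h2.mul hgc)
  have := (intervalIntegral.hasDerivAt_integral_of_dominated_loc_of_deriv_le
    (μ := volume) (a := 0) (b := 2 * Real.pi)
    (F := fun x θ => deriv (circleMap c R) θ • ((circleMap c R θ - x)⁻¹ * g (circleMap c R θ)))
    (F' := fun x θ => deriv (circleMap c R) θ • (((circleMap c R θ - x)^2)⁻¹ * g (circleMap c R θ)))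
    (x₀ := z) (s := ball z δ) (bound := fun _ => R * ((δ^2)⁻¹ * M)) (ball_mem_nhds z hδ0)
    (by
      filter_upwards [ball_mem_nhds z hδ0] with x hx
      exact (hcont x hx).aestronglyMeasurable)
    ((hcont z (mem_ball_self hδ0)).intervalIntegrable _ _)
    (hcont' z (mem_ball_self hδ0)).aestronglyMeasurable
    (by
      refine Eventually.of_forall fun θ _ x hx => ?_
      rw [norm_smul, norm_mul, norm_inv, norm_pow, deriv_circleMap]
      have h1 := hd x hx θ
      have h2 := hM _ (circleMap_mem_sphere c hR.le θ)
      have h3 : ‖circleMap 0 R θ * Complex.I‖ = R := by simp [abs_of_pos hR]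
      rw [h3]
      gcongr)
    intervalIntegrable_const
    (by
      refine Eventually.of_forall fun θ _ x hx => ?_
      apply HasDerivAt.fun_const_smul
      apply HasDerivAt.mul_const
      have h1 : HasDerivAt (fun x => circleMap c R θ - x) (-1) x := by
        simpa using (hasDerivAt_id x).const_sub (circleMap c R θ)
      have h2 := h1.fun_inv (hne x hx θ)
      rw [neg_neg, one_div] at h2
      exact h2)).2
  exact this.differentiableAt

lemma cI_bound {g : ℂ → ℂ} {c : ℂ} {R B : ℝ} (hR : 0 < R) (hB : ∀ ζ ∈ sphere c R, ‖g ζ‖ ≤ B)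
    {z : ℂ} {d : ℝ} (hd : 0 < d) (hz : ∀ ζ ∈ sphere c R, d ≤ ‖ζ - z‖) :
    ‖cI g c R z‖ ≤ R * B / d := by
  unfold cI
  have : ∀ ζ ∈ sphere c R, ‖(ζ - z)⁻¹ * g ζ‖ ≤ B / d := by
    intro ζ hζ
    rw [norm_mul, norm_inv, div_eq_inv_mul]
    have := hz ζ hζ
    have := hB ζ hζ
    gcongr
  refine (circleIntegral.norm_two_pi_i_inv_smul_integral_le_of_norm_le_const hR.le this).trans
    (le_of_eq ?_)
  ring

lemma annulus {g : ℂ → ℂ} {c z : ℂ} {r1 r2 : ℝ} (h1 : 0 < r1) (hz1 : r1 < ‖z - c‖)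
    (hz2 : ‖z - c‖ < r2)
    (hg : ∀ ζ, r1 ≤ ‖ζ - c‖ → ‖ζ - c‖ ≤ r2 → DifferentiableAt ℂ g ζ) :
    cI g c r2 z - cI g c r1 z = g z := by
  have h2 : 0 < r2 := by linarith
  have hann : ∀ ζ ∈ closedBall c r2 \ ball c r1, r1 ≤ ‖ζ - c‖ ∧ ‖ζ - c‖ ≤ r2 := by
    intro ζ hζ
    rw [Set.mem_sdiff, mem_closedBall, mem_ball, dist_eq_norm, not_lt] at hζ
    exact ⟨hζ.2, hζ.1⟩
  have hd : ∮ ζ in C(c, r2), dslope g z ζ = ∮ ζ in C(c, r1), dslope g z ζ := by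
    apply Complex.circleIntegral_eq_of_differentiable_on_annulus_off_countable h1 (by linarith)
      (countable_singleton z)
    · intro ζ hζ
      obtain ⟨ha, hb⟩ := hann ζ hζ
      apply ContinuousAt.continuousWithinAt
      by_cases h : ζ = z
      · subst h
        exact continuousAt_dslope_same.2 (hg _ hz1.le hz2.le)
      · exact (continuousAt_dslope_of_ne h).2 (hg _ ha hb).continuousAt
    · intro ζ hζ
      have := hann ζ ⟨ball_subset_closedBall hζ.1.1, fun h => hζ.1.2 (ball_subset_closedBall h)⟩
      exact (differentiableAt_dslope_of_ne hζ.2).2 (hg _ this.1 this.2)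
  have key : ∀ r, 0 < r → r1 ≤ r → r ≤ r2 → r ≠ ‖z - c‖ →
      ∮ ζ in C(c, r), dslope g z ζ = (∮ ζ in C(c, r), (ζ - z)⁻¹ * g ζ) -
        g z * ∮ ζ in C(c, r), (ζ - z)⁻¹ := by
    intro r hr hr1 hr2 hrz
    have hne : ∀ ζ ∈ sphere c r, ζ - z ≠ 0 := by
      intro ζ hζ h
      rw [sub_eq_zero] at h
      subst h
      exact hrz (mem_sphere_iff_norm.1 hζ).symm
    have hinv : ContinuousOn (fun ζ : ℂ => (ζ - z)⁻¹) (sphere c r) :=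
      (by fun_prop : ContinuousOn (fun ζ : ℂ => ζ - z) (sphere c r)).inv₀ hne
    have hgc : ContinuousOn g (sphere c r) := fun ζ hζ => by
      have := mem_sphere_iff_norm.1 hζ
      exact (hg ζ (by rw [this]; exact hr1) (by rw [this]; exact hr2)).continuousAt.continuousWithinAt
    rw [← circleIntegral.integral_const_mul, ← circleIntegral.integral_sub
      (f := fun ζ => (ζ - z)⁻¹ * g ζ) (g := fun ζ => g z * (ζ - z)⁻¹)
      ((hinv.mul hgc).circleIntegrable hr.le)
      ((continuousOn_const.mul hinv).circleIntegrable hr.le)]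
    apply circleIntegral.integral_congr hr.le
    intro ζ hζ
    simp only
    rw [dslope_of_ne _ (sub_ne_zero.1 (hne ζ hζ)), slope_def_field]
    field_simp
  rw [key r2 h2 (by linarith) le_rfl hz2.ne', key r1 h1 le_rfl (by linarith) hz1.ne,
    circleIntegral.integral_sub_inv_of_mem_ball (by simpa [dist_eq_norm] using hz2)] at hd
  have h0 : ∮ ζ in C(c, r1), (ζ - z)⁻¹ = 0 := by
    apply Complex.circleIntegral_eq_zero_of_differentiable_on_off_countable h1.le countable_empty
    · have : ∀ ζ ∈ closedBall c r1, ζ - z ≠ 0 := by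
        intro ζ hζ h
        rw [sub_eq_zero] at h
        subst h
        rw [mem_closedBall, dist_eq_norm] at hζ
        linarith
      exact (by fun_prop : ContinuousOn (fun ζ : ℂ => ζ - z) _).inv₀ this
    · intro ζ hζ
      have : ζ - z ≠ 0 := by
        intro h
        rw [sub_eq_zero] at h
        subst h
        have := ball_subset_closedBall hζ.1
        rw [mem_closedBall, dist_eq_norm] at this
        linarith
      fun_prop (disch := assumption)
  rw [h0] at hd
  unfold cI
  rw [← smul_sub, smul_eq_mul]
  have hpi : (2 * Real.pi * Complex.I : ℂ) ≠ 0 := Complex.two_pi_I_ne_zero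
  rw [inv_mul_eq_iff_eq_mul₀ hpi]
  linear_combination hd

lemma laurent {U K : Set ℂ} (hU : IsOpen U) (hK : IsClosed K) {g : ℂ → ℂ}
    (hg : DifferentiableOn ℂ g (U \ K)) {c : ℂ} {r1 r2 : ℝ} (h1 : 0 < r1) (h12 : r1 < r2)
    (hb : closedBall c r2 ⊆ U) (hav : ∀ z ∈ K, ‖z - c‖ < r1 ∨ r2 < ‖z - c‖) :
    ∃ F G : ℂ → ℂ, (∀ z, z ∉ K ∩ closedBall c r1 → DifferentiableAt ℂ F z) ∧
      (∀ z ∈ (U \ K) ∪ ball c r2, DifferentiableAt ℂ G z) ∧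
      (∀ z ∈ U \ K, g z = F z + G z) ∧
      (∀ B z, (∀ ζ ∈ sphere c r1, ‖g ζ‖ ≤ B) → r1 < ‖z - c‖ →
        ‖F z‖ ≤ r1 * B / (‖z - c‖ - r1)) ∧
      (∀ B z, (∀ ζ ∈ sphere c r2, ‖g ζ‖ ≤ B) → ‖z - c‖ < r2 →
        ‖G z‖ ≤ r2 * B / (r2 - ‖z - c‖)) := by
  have h2 : 0 < r2 := by linarith
  have hga : ∀ z ∈ U \ K, DifferentiableAt ℂ g z := fun z hz =>
    hg.differentiableAt ((hU.sdiff hK).mem_nhds hz)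
  have hannU : ∀ ζ, r1 ≤ ‖ζ - c‖ → ‖ζ - c‖ ≤ r2 → ζ ∈ U \ K := by
    intro ζ ha hb'
    refine ⟨hb (by rwa [mem_closedBall, dist_eq_norm]), fun h => ?_⟩
    rcases hav ζ h with h | h <;> linarith
  have hgann : ∀ ζ, r1 ≤ ‖ζ - c‖ → ‖ζ - c‖ ≤ r2 → DifferentiableAt ℂ g ζ :=
    fun ζ ha hb' => hga ζ (hannU ζ ha hb')
  have hgs : ∀ r, r1 ≤ r → r ≤ r2 → ContinuousOn g (sphere c r) := fun r ha hb' ζ hζ => by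
    have := mem_sphere_iff_norm.1 hζ
    exact (hgann ζ (by rw [this]; exact ha) (by rw [this]; exact hb')).continuousAt.continuousWithinAt
  have hcn : Continuous fun z : ℂ => ‖z - c‖ := by fun_prop
  have hid : ∀ z, r1 < ‖z - c‖ → ‖z - c‖ < r2 → cI g c r2 z - cI g c r1 z = g z :=
    fun z ha hb' => annulus h1 ha hb' hgann
  classical
  refine ⟨fun z => if r1 < ‖z - c‖ then - cI g c r1 z else g z - cI g c r2 z,
    fun z => if ‖z - c‖ < r2 then cI g c r2 z else g z + cI g c r1 z, ?_, ?_, ?_, ?_, ?_⟩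
  · intro z hz
    by_cases h : r1 < ‖z - c‖
    · have : (fun z => if r1 < ‖z - c‖ then - cI g c r1 z else g z - cI g c r2 z) =ᶠ[𝓝 z]
          fun z => - cI g c r1 z := by
        filter_upwards [(isOpen_lt continuous_const hcn).mem_nhds h] with y hy
        exact if_pos hy
      exact (cI_diff h1 (hgs r1 le_rfl h12.le) h.ne').neg.congr_of_eventuallyEq this
    · push Not at h
      have hzlt : ‖z - c‖ < r2 := by linarith
      have : (fun z => if r1 < ‖z - c‖ then - cI g c r1 z else g z - cI g c r2 z) =ᶠ[𝓝 z]
          fun z => g z - cI g c r2 z := by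
        filter_upwards [(isOpen_lt hcn continuous_const).mem_nhds hzlt] with y hy
        split_ifs with h'
        · rw [← hid y h' hy]; ring
        · rfl
      have hzK : z ∈ U \ K := ⟨hb (by rw [mem_closedBall, dist_eq_norm]; exact hzlt.le),
        fun h' => hz ⟨h', by rw [mem_closedBall, dist_eq_norm]; exact h⟩⟩
      exact ((hga z hzK).sub (cI_diff h2 (hgs r2 h12.le le_rfl) hzlt.ne)).congr_of_eventuallyEq this
  · intro z hz
    by_cases h : ‖z - c‖ < r2
    · have : (fun z => if ‖z - c‖ < r2 then cI g c r2 z else g z + cI g c r1 z) =ᶠ[𝓝 z]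
          fun z => cI g c r2 z := by
        filter_upwards [(isOpen_lt hcn continuous_const).mem_nhds h] with y hy
        exact if_pos hy
      exact (cI_diff h2 (hgs r2 h12.le le_rfl) h.ne).congr_of_eventuallyEq this
    · have hzU : z ∈ U \ K := by
        rcases hz with hz | hz
        · exact hz
        · rw [mem_ball, dist_eq_norm] at hz
          exact absurd hz h
      push Not at h
      have hzlt : r1 < ‖z - c‖ := by linarith
      have : (fun z => if ‖z - c‖ < r2 then cI g c r2 z else g z + cI g c r1 z) =ᶠ[𝓝 z]
          fun z => g z + cI g c r1 z := by
        filter_upwards [(isOpen_lt continuous_const hcn).mem_nhds hzlt] with y hy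
        split_ifs with h'
        · rw [← hid y hy h']; ring
        · rfl
      exact ((hga z hzU).add (cI_diff h1 (hgs r1 le_rfl h12.le) hzlt.ne')).congr_of_eventuallyEq this
  · intro z hz
    simp only
    split_ifs with ha hb' hb'
    · rw [← hid z ha hb']; ring
    · ring
    · ring
    · linarith
  · intro B z hB hz
    simp only [if_pos hz, norm_neg]
    apply cI_bound h1 hB (by linarith)
    intro ζ hζ
    have h3 := norm_sub_norm_le (z - c) (ζ - c)
    rw [mem_sphere_iff_norm.1 hζ, sub_sub_sub_cancel_right, norm_sub_rev z ζ] at h3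
    exact h3
  · intro B z hB hz
    simp only [if_pos hz]
    apply cI_bound h2 hB (by linarith)
    intro ζ hζ
    have h3 := norm_sub_norm_le (ζ - c) (z - c)
    rw [mem_sphere_iff_norm.1 hζ, sub_sub_sub_cancel_right] at h3
    exact h3

end PH
end

section
open Set Metric MeasureTheory Filter Topology
namespace PH

lemma fatten {W A : Set ℂ} (hW : IsOpen W) (hA : IsCompact A) {c : ℂ} {r : ℝ} (hr : 0 < r)
    (hb : closedBall c r ⊆ W) (hs : Disjoint (sphere c r) A) :
    ∃ r1 r2, 0 < r1 ∧ r1 < r ∧ r < r2 ∧ closedBall c r2 ⊆ W ∧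
      ∀ z ∈ A, ‖z - c‖ < r1 ∨ r2 < ‖z - c‖ := by
  obtain ⟨δ, hδ, hδW⟩ := (isCompact_closedBall c r).exists_cthickening_subset_open hW hb
  rw [cthickening_closedBall hδ.le hr.le] at hδW
  obtain ⟨η, hη, hηA⟩ : ∃ η > 0, ∀ z ∈ A, η ≤ |‖z - c‖ - r| := by
    rcases A.eq_empty_or_nonempty with rfl | hne
    · exact ⟨1, one_pos, by simp⟩
    · obtain ⟨z, hz, hm⟩ := hA.exists_isMinOn hne
        (f := fun z => |‖z - c‖ - r|) (by fun_prop)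
      refine ⟨|‖z - c‖ - r|, abs_pos.2 (sub_ne_zero.2 fun h => ?_), fun y hy => hm hy⟩
      exact hs.le_bot ⟨mem_sphere_iff_norm.2 h, hz⟩
  set ε := min (min δ (η / 2)) (r / 2) with hε
  have hε0 : 0 < ε := by positivity
  have e1 : ε ≤ δ := (min_le_left _ _).trans (min_le_left _ _)
  have e2 : ε ≤ η / 2 := (min_le_left _ _).trans (min_le_right _ _)
  have e3 : ε ≤ r / 2 := min_le_right _ _
  refine ⟨r - ε, r + ε, by linarith, by linarith, by linarith,
    (closedBall_subset_closedBall (by linarith)).trans hδW, fun z hz => ?_⟩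
  have := hηA z hz
  rcases abs_cases (‖z - c‖ - r) with h | h
  · right; linarith
  · left; linarith

lemma split_aux {W : Set ℂ} (hW : IsOpen W) (r : ℂ → ℝ) (t : Finset ℂ) :
    ∀ A : Set ℂ, IsCompact A → (∀ c ∈ t, 0 < r c ∧ closedBall c (r c) ⊆ W ∧
      Disjoint (sphere c (r c)) A) → (A ⊆ ⋃ c ∈ t, ball c (r c)) →
    ∃ C : ℝ, 0 ≤ C ∧ ∃ Z : Set ℂ, IsCompact Z ∧ Z ⊆ W \ A ∧ ∀ (g : ℂ → ℂ) (B : ℝ), 0 ≤ B →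
      DifferentiableOn ℂ g (W \ A) → (∀ z ∈ Z, ‖g z‖ ≤ B) →
      ∃ F G : ℂ → ℂ, (∀ z, z ∉ A → DifferentiableAt ℂ F z) ∧ DifferentiableOn ℂ G W ∧
        (∀ z ∈ W \ A, g z = F z + G z) ∧ ∀ z, z ∉ W → ‖F z‖ ≤ C * B := by
  induction t using Finset.induction_on with
  | empty =>
    intro A hA _ hc
    have hA0 : A = ∅ := by simpa using hc
    subst hA0
    refine ⟨0, le_rfl, ∅, isCompact_empty, by simp, fun g B hB hg _ => ?_⟩
    exact ⟨fun _ => 0, g, fun z _ => by fun_prop, by simpa using hg, by simp, by simp⟩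
  | insert c t hct ih =>
    intro A hA hr hc
    obtain ⟨h0, hb, hs⟩ := hr c (Finset.mem_insert_self _ _)
    obtain ⟨r1, r2, h1, h1r, hr2, hb2, hav⟩ := fatten hW hA h0 hb hs
    set ρ := r c
    have hA2c : IsCompact (A \ ball c ρ) := hA.diff isOpen_ball
    obtain ⟨C, hC, Z, hZ, hZW, ih⟩ := ih (A \ ball c ρ) hA2c
      (fun c' hc' => by
        obtain ⟨a, b, d⟩ := hr c' (Finset.mem_insert_of_mem hc')
        exact ⟨a, b, d.mono_right sdiff_subset⟩)
      (fun z hz => by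
        have := hc hz.1
        rw [Finset.set_biUnion_insert] at this
        exact this.resolve_left hz.2)
    have hnorm : ∀ z s, z ∈ ball c s ↔ ‖z - c‖ < s := fun z s => by rw [mem_ball, dist_eq_norm]
    have q1 : 0 ≤ r1 / (ρ - r1) := div_nonneg h1.le (by linarith)
    have q2 : 0 ≤ r2 / (r2 - ρ) := div_nonneg (by linarith) (by linarith)
    set C1 := 1 + r1 / (ρ - r1) + r2 / (r2 - ρ) with hC1
    have hC10 : 0 ≤ C1 := by positivity
    have hsph : ∀ s, r1 ≤ s → s ≤ r2 → sphere c s ⊆ W \ A := by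
      intro s hs1 hs2 z hz
      rw [mem_sphere_iff_norm] at hz
      refine ⟨hb2 (by rw [mem_closedBall, dist_eq_norm, hz]; exact hs2), fun h => ?_⟩
      rcases hav z h with h | h <;> linarith
    refine ⟨r1 / (ρ - r1) + C * C1, by positivity, (Z \ ball c ρ) ∪ sphere c r1 ∪ sphere c r2,
      ((hZ.diff isOpen_ball).union (isCompact_sphere _ _)).union (isCompact_sphere _ _),
      union_subset (union_subset ?_ (hsph r1 le_rfl (by linarith))) (hsph r2 (by linarith) le_rfl),
      fun g B hB hg hgB => ?_⟩
    · intro z hz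
      exact ⟨(hZW hz.1).1, fun h => (hZW hz.1).2 ⟨h, hz.2⟩⟩
    obtain ⟨F1, G1, hF1, hG1, hFG, hF1b, hG1b⟩ := laurent hW hA.isClosed hg h1 (by linarith) hb2 hav
    have hF1B : ∀ z, ρ ≤ ‖z - c‖ → ‖F1 z‖ ≤ r1 / (ρ - r1) * B := by
      intro z hz
      refine (hF1b B z (fun ζ hζ => hgB ζ (Or.inl (Or.inr hζ))) (by linarith)).trans ?_
      rw [div_mul_eq_mul_div]
      have : 0 < ρ - r1 := by linarith
      gcongr
    have hG1B : ∀ z, ‖z - c‖ < ρ → ‖G1 z‖ ≤ r2 / (r2 - ρ) * B := by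
      intro z hz
      refine (hG1b B z (fun ζ hζ => hgB ζ (Or.inr hζ)) (by linarith)).trans ?_
      rw [div_mul_eq_mul_div]
      have : 0 < r2 - ρ := by linarith
      have : 0 ≤ r2 := by linarith
      gcongr
    obtain ⟨F2, G2, hF2, hG2, hFG2, hF2b⟩ := ih G1 (C1 * B) (by positivity)
      (fun z hz => by
        apply DifferentiableAt.differentiableWithinAt
        apply hG1
        by_cases h : z ∈ A
        · right
          have : z ∈ ball c ρ := by
            by_contra h'
            exact hz.2 ⟨h, h'⟩
          exact ball_subset_ball hr2.le this
        · exact Or.inl ⟨hz.1, h⟩)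
      (fun z hz => by
        by_cases h : ‖z - c‖ < ρ
        · refine (hG1B z h).trans ?_
          gcongr
          rw [hC1]; linarith
        · have hzn : z ∉ ball c ρ := by rwa [hnorm]
          have hzA : z ∈ W \ A := ⟨(hZW hz).1, fun h' => (hZW hz).2 ⟨h', hzn⟩⟩
          have e : G1 z = g z - F1 z := by rw [hFG z hzA]; ring
          have a1 := hgB z (Or.inl (Or.inl ⟨hz, hzn⟩))
          have a2 := hF1B z (not_lt.1 h)
          rw [e]
          refine (norm_sub_le _ _).trans ?_
          have : 0 ≤ r2 / (r2 - ρ) * B := by positivity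
          rw [hC1]
          linarith)
    refine ⟨fun z => F1 z + F2 z, G2, fun z hz => ?_, hG2, fun z hz => ?_, fun z hz => ?_⟩
    · exact (hF1 z fun h => hz h.1).add (hF2 z fun h => hz h.1)
    · rw [hFG z hz, hFG2 z ⟨hz.1, fun h => hz.2 h.1⟩]
      ring
    · have hz' : ρ ≤ ‖z - c‖ := by
        by_contra h
        push Not at h
        exact hz (hb (ball_subset_closedBall ((hnorm z ρ).2 h)))
      have := hF1B z hz'
      have := hF2b z hz
      refine (norm_add_le _ _).trans ?_
      linarith

lemma split {W A : Set ℂ} (hW : IsOpen W) (hA : IsCompact A) (hp : PolarSet A) (hAW : A ⊆ W) :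
    ∃ C : ℝ, 0 ≤ C ∧ ∃ Z : Set ℂ, IsCompact Z ∧ Z ⊆ W \ A ∧ ∀ (g : ℂ → ℂ) (B : ℝ), 0 ≤ B →
      DifferentiableOn ℂ g (W \ A) → (∀ z ∈ Z, ‖g z‖ ≤ B) →
      ∃ F G : ℂ → ℂ, (∀ z, z ∉ A → DifferentiableAt ℂ F z) ∧ DifferentiableOn ℂ G W ∧
        (∀ z ∈ W \ A, g z = F z + G z) ∧ ∀ z, z ∉ W → ‖F z‖ ≤ C * B := by
  have : ∀ z ∈ A, ∃ r, 0 < r ∧ closedBall z r ⊆ W ∧ Disjoint (sphere z r) A := by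
    intro z hz
    obtain ⟨r, h1, -, h2, h3⟩ := good_ball hW (fun z _ h => hA.isClosed.closure_subset h) hp
      (hAW hz) one_pos
    exact ⟨r, h1, h2, h3⟩
  choose! r hr0 hrD hrA using this
  obtain ⟨t, htK, htc⟩ := hA.elim_nhds_subcover (fun z => ball z (r z))
    (fun z hz => ball_mem_nhds z (hr0 z hz))
  exact split_aux hW r t A hA
    (fun c hc => ⟨hr0 c (htK c hc), hrD c (htK c hc), hrA c (htK c hc)⟩) htc

end PH
end

section
open Set Metric MeasureTheory Filter Topology
namespace PH

lemma removable {D A : Set ℂ} (hD : IsOpen D)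
    (hAclosed : ∀ z ∈ D, z ∈ closure A → z ∈ A) (hp : PolarSet A) {f : ℂ → ℂ}
    (hf : DifferentiableOn ℂ f (D \ A)) {a : ℂ} (ha : a ∈ A) {r : ℝ} (hr : 0 < r)
    (hb : closedBall a r ⊆ D) (hs : Disjoint (sphere a r) A) {B : ℝ}
    (hB : ∀ z ∈ ball a r \ A, ‖f z‖ ≤ B) :
    ∃ g : ℂ → ℂ, DifferentiableOn ℂ g (ball a r) ∧ EqOn f g (ball a r \ A) := by
  obtain ⟨δ, hδ, hδW⟩ := (isCompact_closedBall a r).exists_cthickening_subset_open hD hb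
  rw [cthickening_closedBall hδ.le hr.le] at hδW
  set r' := δ + r with hr'
  have hK : IsCompact (A ∩ closedBall a r') :=
    inter_compact hAclosed (isCompact_closedBall _ _) hδW
  obtain ⟨r1, r2, h1, h1r, hr2, hb2, hav⟩ := fatten (W := ball a r') isOpen_ball hK hr
    (closedBall_subset_ball (by linarith)) (hs.mono_right inter_subset_left)
  have hUA : ∀ z ∈ ball a r', z ∉ A ∩ closedBall a r' → z ∉ A := fun z hz h h' =>
    h ⟨h', ball_subset_closedBall hz⟩
  obtain ⟨F, G, hF, hG, hFG, hFb, -⟩ := laurent (U := ball a r') isOpen_ball hK.isClosed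
    (g := f) (hf.mono fun z hz => ⟨hδW (ball_subset_closedBall hz.1), hUA z hz.1 hz.2⟩)
    h1 (by linarith) hb2 hav
  have hGc : ContinuousOn G (closedBall a r) := fun z hz =>
    (hG z (Or.inr (closedBall_subset_ball hr2 hz))).continuousAt.continuousWithinAt
  obtain ⟨MG, hMG⟩ := (isCompact_closedBall a r).exists_bound_of_continuousOn hGc
  have hr1A : sphere a r1 ⊆ D \ A := by
    intro z hz
    have hz' := mem_sphere_iff_norm.1 hz
    have hzb : z ∈ closedBall a r := by
      rw [mem_closedBall, dist_eq_norm]; linarith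
    refine ⟨hb hzb, fun h => ?_⟩
    rcases hav z ⟨h, closedBall_subset_closedBall (by linarith) hzb⟩ with h | h <;> linarith
  obtain ⟨B1, hB1⟩ := (isCompact_sphere a r1).exists_bound_of_continuousOn
    (hf.continuousOn.mono hr1A)
  set K1 := (A ∩ closedBall a r') ∩ closedBall a r1 with hK1
  have hK1c : IsCompact K1 := hK.inter_right isClosed_closedBall
  have hK1p : PolarSet K1 := polar_mono hp (inter_subset_left.trans inter_subset_left)
  have hK1n : K1.Nonempty := ⟨a, ⟨ha, mem_closedBall_self (by linarith)⟩,
    mem_closedBall_self h1.le⟩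
  have hB1n : 0 ≤ B1 := by
    have : a + r1 ∈ sphere a r1 := by simp [h1.le]
    exact (norm_nonneg _).trans (hB1 _ this)
  have hFz : ∀ z, z ∉ K1 → F z = 0 := by
    intro z hz
    rw [← norm_le_zero_iff]
    apply le_of_forall_pos_le_add
    intro m hm
    rw [zero_add]
    set R := r + r1 + r1 * B1 / m + ‖z - a‖ + 1 with hR
    have hq : 0 ≤ r1 * B1 / m := by positivity
    have hRz : ‖z - a‖ < R := by have := norm_nonneg (z - a); linarith
    refine max_principle (K := K1) (O := ball a R \ K1) hK1c hK1n hK1p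
      (isOpen_ball.sdiff hK1c.isClosed) (isBounded_ball.subset sdiff_subset)
      disjoint_sdiff_left
      (fun y hy => (hF y hy.2).differentiableWithinAt)
      (fun y hy => (hF y hy.2).continuousAt.continuousWithinAt) hm
      (C := max (B + MG) (r1 * B1 / (r - r1))) ?_ ?_ z
      ⟨by rwa [mem_ball, dist_eq_norm], hz⟩
    · intro y hy
      by_cases hyr : ‖y - a‖ < r
      · refine le_trans ?_ (le_max_left _ _)
        have hyb : y ∈ ball a r := by rwa [mem_ball, dist_eq_norm]
        have hyA : y ∉ A := by
          intro h
          have hyA' : y ∈ A ∩ closedBall a r' :=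
            ⟨h, closedBall_subset_closedBall (by linarith) (ball_subset_closedBall hyb)⟩
          rcases hav y hyA' with h' | h'
          · exact hy.2 ⟨hyA', by rw [mem_closedBall, dist_eq_norm]; exact h'.le⟩
          · linarith
        have e : F y = f y - G y := by
          rw [hFG y ⟨ball_subset_ball (by linarith) hyb, fun h => hyA h.1⟩]; ring
        rw [e]
        exact (norm_sub_le _ _).trans (add_le_add (hB y ⟨hyb, hyA⟩)
          (hMG y (ball_subset_closedBall hyb)))
      · refine le_trans ?_ (le_max_right _ _)
        push Not at hyr
        refine (hFb B1 y hB1 (by linarith)).trans ?_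
        have : 0 < r - r1 := by linarith
        gcongr
    · intro y hy hyK
      have hyR : ‖y - a‖ = R := by
        have h1 : y ∈ closure (ball a R \ K1) := frontier_subset_closure hy
        have h2 : y ∈ closedBall a R := closure_ball_subset_closedBall (closure_mono sdiff_subset h1)
        have h3 : y ∉ ball a R \ K1 := by
          intro h
          have := (isOpen_ball.sdiff hK1c.isClosed).interior_eq ▸ h
          exact hy.2 this
        have h4 : y ∉ ball a R := fun h => h3 ⟨h, hyK⟩
        rw [mem_closedBall, dist_eq_norm] at h2
        rw [mem_ball, dist_eq_norm] at h4
        linarith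
      have hzn := norm_nonneg (z - a)
      refine (hFb B1 y hB1 (by linarith)).trans ?_
      rw [hyR, div_le_iff₀ (by linarith)]
      have : r1 * B1 = m * (r1 * B1 / m) := by field_simp
      rw [this]
      gcongr
      linarith
  refine ⟨G, fun z hz => (hG z (Or.inr (ball_subset_ball hr2.le hz))).differentiableWithinAt,
    fun z hz => ?_⟩
  have h3 : z ∉ A ∩ closedBall a r' := fun h => hz.2 h.1
  rw [hFG z ⟨ball_subset_ball (by linarith) hz.1, h3⟩, hFz z fun h => h3 h.1, zero_add]

/-- Points of `A` accessible through connected open sets on which `f` is large. -/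
def Good (D A : Set ℂ) (f : ℂ → ℂ) (a : ℂ) : Prop :=
  ∀ R : ℝ, ∃ O : Set ℂ, IsOpen O ∧ IsConnected O ∧ O ⊆ D \ A ∧ (∀ z ∈ O, R < ‖f z‖) ∧
    a ∈ closure O

lemma comp_unbounded {K S : Set ℂ} {f : ℂ → ℂ} (hK : IsCompact K) (hKn : K.Nonempty)
    (hp : PolarSet K) (hS : IsOpen S) (hSb : Bornology.IsBounded S) (hSK : Disjoint S K)
    (hf : ∀ z ∈ closure S \ K, DifferentiableAt ℂ f z) {m : ℝ} (hm : 0 < m)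
    (hSf : ∀ z ∈ S, m < ‖f z‖)
    (hfr : ∀ z ∈ closure S, z ∉ K → z ∉ S → ‖f z‖ ≤ m) {x : ℂ} (hx : x ∈ S) (C : ℝ) :
    ∃ y ∈ connectedComponentIn S x, C < ‖f y‖ := by
  by_contra hcon
  push Not at hcon
  have hsub := connectedComponentIn_subset S x
  have hO : IsOpen (connectedComponentIn S x) := hS.connectedComponentIn
  have := max_principle (F := f) hK hKn hp hO (hSb.subset hsub) (hSK.mono_left hsub)
    (fun z hz => (hf z ⟨subset_closure (hsub hz), fun h => hSK.le_bot ⟨hsub hz, h⟩⟩).differentiableWithinAt)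
    (fun z hz => (hf z ⟨closure_mono hsub hz.1, hz.2⟩).continuousAt.continuousWithinAt)
    hm hcon
    (fun z hz hzK => by
      apply hfr z (closure_mono hsub (frontier_subset_closure hz)) hzK
      intro hzS
      have hzc := frontier_subset_closure hz
      have hzO : IsOpen (connectedComponentIn S z) := hS.connectedComponentIn
      obtain ⟨y, hy1, hy2⟩ := mem_closure_iff.1 hzc _ hzO (mem_connectedComponentIn hzS)
      have e1 := connectedComponentIn_eq hy1
      have e2 := connectedComponentIn_eq hy2
      have hzx : z ∈ connectedComponentIn S x := by
        rw [e2, ← e1]; exact mem_connectedComponentIn hzS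
      exact hz.2 (by rw [hO.interior_eq]; exact hzx))
    x (mem_connectedComponentIn hx)
  linarith [hSf x hx]

lemma iversen {D A : Set ℂ} (hD : IsOpen D) (hAD : A ⊆ D)
    (hAclosed : ∀ z ∈ D, z ∈ closure A → z ∈ A) (hp : PolarSet A) {f : ℂ → ℂ}
    (hf : DifferentiableOn ℂ f (D \ A))
    (hnoext : ∀ a ∈ A, ¬ ∃ (V : Set ℂ) (g : ℂ → ℂ), IsOpen V ∧ a ∈ V ∧ V ⊆ D ∧
      DifferentiableOn ℂ g V ∧ Set.EqOn f g (V \ A)) {a0 : ℂ} (ha0 : a0 ∈ A) {δ : ℝ}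
    (hδ : 0 < δ) : ∃ a ∈ A, dist a a0 < δ ∧ Good D A f a := by
  obtain ⟨r, hr, hrδ, hb, hs⟩ := good_ball hD hAclosed hp (hAD ha0) hδ
  have hK : IsCompact (A ∩ closedBall a0 r) := inter_compact hAclosed (isCompact_closedBall _ _) hb
  set K := A ∩ closedBall a0 r with hKdef
  have hKp : PolarSet K := polar_mono hp inter_subset_left
  have hKn : K.Nonempty := ⟨a0, ha0, mem_closedBall_self hr.le⟩
  have hunb : ∀ C : ℝ, ∃ z ∈ ball a0 r \ A, C < ‖f z‖ := by
    intro C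
    by_contra hcon
    push Not at hcon
    obtain ⟨g, hg, hfg⟩ := removable hD hAclosed hp hf ha0 hr hb hs hcon
    exact hnoext a0 ha0 ⟨ball a0 r, g, isOpen_ball, mem_ball_self hr,
      ball_subset_closedBall.trans hb, hg, hfg⟩
  have hDA : IsOpen (D \ A) := by
    have : D \ A = D \ closure A := by
      ext z
      exact ⟨fun h => ⟨h.1, fun h' => h.2 (hAclosed z h.1 h')⟩,
        fun h => ⟨h.1, fun h' => h.2 (subset_closure h')⟩⟩
    rw [this]
    exact hD.sdiff isClosed_closure
  have hfd : ∀ z ∈ D \ A, DifferentiableAt ℂ f z := fun z hz =>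
    hf.differentiableAt (hDA.mem_nhds hz)
  have hsD : sphere a0 r ⊆ D \ A := fun z hz =>
    ⟨hb (sphere_subset_closedBall hz), fun h => hs.le_bot ⟨hz, h⟩⟩
  obtain ⟨m0, hm0⟩ := (isCompact_sphere a0 r).exists_bound_of_continuousOn
    (hf.continuousOn.mono hsD)
  set M : ℕ → ℝ := fun k => |m0| + 1 + k with hM
  have hM0 : ∀ k, 0 < M k := fun k => by positivity
  set S : ℕ → Set ℂ := fun k => {z | z ∈ ball a0 r \ A ∧ M k < ‖f z‖} with hSdef
  have hVD : ball a0 r \ A ⊆ D \ A := fun z hz => ⟨hb (ball_subset_closedBall hz.1), hz.2⟩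
  have hV : IsOpen (ball a0 r \ A) := by
    have : ball a0 r \ A = ball a0 r ∩ (D \ A) := by
      ext z
      exact ⟨fun h => ⟨h.1, hVD h⟩, fun h => ⟨h.1, h.2.2⟩⟩
    rw [this]
    exact isOpen_ball.inter hDA
  have hSo : ∀ k, IsOpen (S k) := by
    intro k
    have hc : ContinuousOn (fun z => ‖f z‖) (ball a0 r \ A) := (hf.continuousOn.mono hVD).norm
    exact hc.isOpen_inter_preimage hV (isOpen_Ioi (a := M k))
  have hScl : ∀ k, closure (S k) ⊆ closedBall a0 r := fun k =>
    closure_minimal (fun z hz => ball_subset_closedBall hz.1.1) isClosed_closedBall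
  have step : ∀ k, ∀ x ∈ S k, ∃ y ∈ connectedComponentIn (S k) x, y ∈ S (k + 1) := by
    intro k x hx
    obtain ⟨y, hy, hyM⟩ := comp_unbounded (f := f) hK hKn hKp (hSo k)
      (isBounded_ball.subset (fun z hz => hz.1.1))
      (by rw [Set.disjoint_left]; exact fun z hz h => hz.1.2 h.1)
      (fun z hz => hfd z ⟨hb (hScl k hz.1), fun h => hz.2 ⟨h, hScl k hz.1⟩⟩)
      (hM0 k) (fun z hz => hz.2)
      (fun z hz hzK hzS => by
        have hzb := hScl k hz
        have hzA : z ∉ A := fun h => hzK ⟨h, hzb⟩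
        by_cases h : z ∈ ball a0 r
        · by_contra hcon
          push Not at hcon
          exact hzS ⟨⟨h, hzA⟩, hcon⟩
        · have hzs : z ∈ sphere a0 r := by
            rw [mem_sphere]
            rw [mem_ball] at h
            rw [mem_closedBall] at hzb
            linarith
          have h1 := hm0 z hzs
          have h2 := le_abs_self m0
          have h3 : (0:ℝ) ≤ k := k.cast_nonneg
          simp only [hM]
          linarith) hx (M (k + 1))
    exact ⟨y, hy, (connectedComponentIn_subset _ _ hy).1, hyM⟩
  choose! nx hnx1 hnx2 using step
  obtain ⟨x0, hx0, hx0M⟩ := hunb (M 0)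
  let x : ℕ → ℂ := fun k => Nat.rec x0 (fun k y => nx k y) k
  have hxs : ∀ k, x (k + 1) = nx k (x k) := fun k => rfl
  have hxS : ∀ k, x k ∈ S k := by
    intro k
    induction k with
    | zero => exact ⟨hx0, hx0M⟩
    | succ k ih => rw [hxs]; exact hnx2 k _ ih
  set O : ℕ → Set ℂ := fun k => connectedComponentIn (S k) (x k) with hO
  have hOsub : ∀ k, O (k + 1) ⊆ O k := by
    intro k
    have h1 : x (k + 1) ∈ O k := by rw [hxs]; exact hnx1 k _ (hxS k)
    have h2 : O k = connectedComponentIn (S k) (x (k + 1)) := connectedComponentIn_eq h1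
    rw [h2]
    apply isPreconnected_connectedComponentIn.subset_connectedComponentIn
      (mem_connectedComponentIn (hxS (k + 1)))
    refine (connectedComponentIn_subset _ _).trans fun z hz => ⟨hz.1, lt_of_le_of_lt ?_ hz.2⟩
    simp only [hM]; push_cast; linarith
  obtain ⟨a, ha⟩ := IsCompact.nonempty_iInter_of_sequence_nonempty_isCompact_isClosed
    (fun k => closure (O k)) (fun k => closure_mono (hOsub k))
    (fun k => ⟨x k, subset_closure (mem_connectedComponentIn (hxS k))⟩)
    ((isCompact_closedBall a0 r).of_isClosed_subset isClosed_closure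
      ((closure_mono (connectedComponentIn_subset _ _)).trans (hScl 0)))
    (fun k => isClosed_closure)
  rw [mem_iInter] at ha
  have hab : a ∈ closedBall a0 r := hScl 0 (closure_mono (connectedComponentIn_subset _ _) (ha 0))
  have hOS : ∀ k, O k ⊆ S k := fun k => connectedComponentIn_subset _ _
  have haA : a ∈ A := by
    by_contra hcon
    have haD : a ∈ D \ A := ⟨hb hab, hcon⟩
    have hca : ContinuousAt (fun z => ‖f z‖) a := (hfd a haD).continuousAt.norm
    have : ∀ k, M k ≤ ‖f a‖ := by
      intro k
      by_contra hlt
      push Not at hlt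
      have := hca.eventually (gt_mem_nhds hlt)
      obtain ⟨y, hy1, hy2⟩ := mem_closure_iff_nhds.1 (ha k) _ this
      have := (hOS k hy2).2
      rw [mem_ofPred_eq] at hy1
      linarith
    obtain ⟨k, hk⟩ := exists_nat_gt (‖f a‖)
    have h1 := this k
    have h2 := abs_nonneg m0
    simp only [hM] at h1
    linarith
  refine ⟨a, haA, (mem_closedBall.1 hab).trans_lt hrδ, fun R => ?_⟩
  obtain ⟨k, hk⟩ := exists_nat_gt R
  refine ⟨O k, (hSo k).connectedComponentIn, isConnected_connectedComponentIn_iff.2 (hxS k),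
    fun z hz => hVD (hOS k hz).1, fun z hz => ?_, ha k⟩
  have h1 := (hOS k hz).2
  have h2 := abs_nonneg m0
  simp only [hM] at h1
  linarith

end PH
end

section
open Set Metric MeasureTheory Filter Topology
namespace PH

lemma phi_bound {d : ℝ} (hd : 0 < d) : - Real.log (1 - Real.exp (-d)) ≤ 2 / √d := by
  have hs : 0 < √d := Real.sqrt_pos.2 hd
  have hss : √d * √d = d := Real.mul_self_sqrt hd.le
  have h1 : Real.exp (-d) ≤ 1 / (1 + d) := by
    rw [Real.exp_neg, ← one_div]
    have := Real.add_one_le_exp d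
    gcongr
    linarith
  have h2 : d / (1 + d) ≤ 1 - Real.exp (-d) := by
    have : d / (1 + d) = 1 - 1 / (1 + d) := by field_simp; ring
    rw [this]; linarith
  have h3 : 0 < d / (1 + d) := by positivity
  have h4 : (d / (1 + d))⁻¹ ≤ (1 + 1 / √d) ^ 2 := by
    have e : (d / (1 + d))⁻¹ = 1 + (1 / √d) ^ 2 := by
      rw [inv_div, div_pow, one_pow, Real.sq_sqrt hd.le]; field_simp; ring
    rw [e]
    have : 0 < 1 / √d := by positivity
    nlinarith
  calc - Real.log (1 - Real.exp (-d)) ≤ - Real.log (d / (1 + d)) := by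
        have := Real.log_le_log h3 h2
        linarith
    _ = Real.log (d / (1 + d))⁻¹ := by rw [Real.log_inv]
    _ ≤ Real.log ((1 + 1 / √d) ^ 2) := Real.log_le_log (by positivity) h4
    _ = 2 * Real.log (1 + 1 / √d) := by rw [Real.log_pow]; norm_num
    _ ≤ 2 * (1 / √d) := by
        have := Real.log_le_sub_one_of_pos (show 0 < 1 + 1 / √d by positivity)
        linarith
    _ = 2 / √d := by ring

lemma sum_inv_sqrt (n : ℕ) : ∑ j ∈ Finset.range n, 1 / √((j:ℝ) + 1) ≤ 2 * √(n:ℝ) := by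
  induction n with
  | zero => simp
  | succ n ih =>
    rw [Finset.sum_range_succ]
    push_cast
    have hb : 0 < √((n:ℝ) + 1) := Real.sqrt_pos.2 (by positivity)
    have ha : 0 ≤ √(n:ℝ) := Real.sqrt_nonneg _
    have hbb : √((n:ℝ) + 1) * √((n:ℝ) + 1) = n + 1 := Real.mul_self_sqrt (by positivity)
    have haa : √(n:ℝ) * √(n:ℝ) = n := Real.mul_self_sqrt (by positivity)
    have : 1 / √((n:ℝ) + 1) ≤ 2 * √((n:ℝ) + 1) - 2 * √(n:ℝ) := by
      rw [div_le_iff₀ hb]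
      nlinarith [sq_nonneg (√((n:ℝ) + 1) - √(n:ℝ))]
    linarith

lemma excess {η T x : ℝ} (hη : 0 < η) (hT : 0 ≤ T) (n : ℕ) (c : ℕ → ℝ)
    (h1 : ∀ i < n, c i ≤ T) (h2 : ∀ i < n, x ≠ (i + 1) * η → c i ≤ 2 / √|x - (i + 1) * η|) :
    ∑ i ∈ Finset.range n, c i ≤ 2 * T + 8 * (√(n:ℝ) / √η) := by
  set ψ : ℕ → ℝ := fun j => if j = 0 then T else 2 / √(j * η) with hψ
  have hψ0 : ∀ j, 0 ≤ ψ j := fun j => by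
    simp only [hψ]; split_ifs
    · exact hT
    · positivity
  have hψs : ∑ j ∈ Finset.range (n + 1), ψ j ≤ T + 4 * (√(n:ℝ) / √η) := by
    rw [Finset.sum_range_succ']
    have : ∑ j ∈ Finset.range n, ψ (j + 1) = (2 / √η) * ∑ j ∈ Finset.range n, 1 / √((j:ℝ) + 1) := by
      rw [Finset.mul_sum]
      refine Finset.sum_congr rfl fun j _ => ?_
      simp only [hψ, Nat.add_eq_zero_iff, one_ne_zero, and_false, if_false]
      push_cast
      rw [Real.sqrt_mul (by positivity)]
      field_simp
    rw [this]
    have h3 := mul_le_mul_of_nonneg_left (sum_inv_sqrt n) (show 0 ≤ 2 / √η by positivity)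
    have e : 2 / √η * (2 * √(n:ℝ)) = 4 * (√(n:ℝ) / √η) := by ring
    rw [e] at h3
    simp only [hψ, if_true]
    linarith
  have hcψ : ∀ i < n, ∀ j : ℕ, (j:ℝ) * η ≤ |x - (i + 1) * η| → c i ≤ ψ j := by
    intro i hi j hj
    simp only [hψ]
    split_ifs with h0
    · exact h1 i hi
    · have hjp : (0:ℝ) < j * η := by
        have : (0:ℝ) < j := by exact_mod_cast Nat.pos_of_ne_zero h0
        positivity
      have hne : x ≠ (i + 1) * η := by
        intro h
        rw [h, sub_self, abs_zero] at hj
        linarith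
      refine (h2 i hi hne).trans ?_
      have := Real.sqrt_pos.2 hjp
      gcongr
  set m := min n ⌊x / η⌋₊ with hm
  have hmn : m ≤ n := min_le_left _ _
  have hA : ∀ i < m, c i ≤ ψ (m - 1 - i) := by
    intro i hi
    apply hcψ i (by omega)
    have hfl : m ≤ ⌊x / η⌋₊ := min_le_right _ _
    have hx0 : (m:ℝ) ≤ x / η := by
      refine (Nat.cast_le.2 hfl).trans (Nat.floor_le ?_)
      by_contra hneg
      push Not at hneg
      rw [Nat.floor_of_nonpos hneg.le] at hfl
      omega
    rw [le_div_iff₀ hη] at hx0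
    have e : ((m - 1 - i : ℕ) : ℝ) = m - 1 - i := by
      rw [Nat.cast_sub (by omega), Nat.cast_sub (by omega)]; simp
    rw [e]
    refine le_trans ?_ (le_abs_self _)
    linarith
  have hB : ∀ i, m ≤ i → i < n → c i ≤ ψ (i - m) := by
    intro i hi hin
    apply hcψ i hin
    have hfl : m = ⌊x / η⌋₊ := by
      rcases min_choice n ⌊x / η⌋₊ with h | h
      · rw [← hm] at h; omega
      · exact h
    have hx0 : x / η < m + 1 := by rw [hfl]; exact Nat.lt_floor_add_one _
    rw [div_lt_iff₀ hη] at hx0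
    rw [Nat.cast_sub hi, abs_sub_comm]
    refine le_trans ?_ (le_abs_self _)
    linarith
  have hsplit : ∑ i ∈ Finset.range n, c i =
      ∑ i ∈ Finset.range m, c i + ∑ i ∈ Finset.Ico m n, c i :=
    (Finset.sum_range_add_sum_Ico c hmn).symm
  have hsA : ∑ i ∈ Finset.range m, c i ≤ ∑ j ∈ Finset.range (n + 1), ψ j := by
    calc _ ≤ ∑ i ∈ Finset.range m, ψ (m - 1 - i) :=
          Finset.sum_le_sum fun i hi => hA i (Finset.mem_range.1 hi)
      _ = ∑ i ∈ Finset.range m, ψ i := Finset.sum_range_reflect ψ m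
      _ ≤ _ := Finset.sum_le_sum_of_subset_of_nonneg
          (Finset.range_subset_range.2 (by omega)) fun j _ _ => hψ0 j
  have hsB : ∑ i ∈ Finset.Ico m n, c i ≤ ∑ j ∈ Finset.range (n + 1), ψ j := by
    calc _ ≤ ∑ i ∈ Finset.Ico m n, ψ (i - m) :=
          Finset.sum_le_sum fun i hi => hB i (Finset.mem_Ico.1 hi).1 (Finset.mem_Ico.1 hi).2
      _ = ∑ i ∈ Finset.range (n - m), ψ i := by
          rw [Finset.sum_Ico_eq_sum_range]
          exact Finset.sum_congr rfl fun j _ => by congr 1; omega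
      _ ≤ _ := Finset.sum_le_sum_of_subset_of_nonneg
          (Finset.range_subset_range.2 (by omega)) fun j _ _ => hψ0 j
  rw [hsplit]
  linarith

lemma term_bound {a l z : ℂ} {s τ y : ℝ} (hs : 0 < s) (hτ : 0 < τ)
    (hl : ‖l - a‖ = s * Real.exp (-y)) (hz : z ≠ a)
    (hxy : - Real.log (‖z - a‖ / s) ≠ y) :
    Real.log s - lk τ z l - y ≤ 2 / √|- Real.log (‖z - a‖ / s) - y| := by
  set x := - Real.log (‖z - a‖ / s) with hx
  have hza : 0 < ‖z - a‖ := norm_pos_iff.2 (sub_ne_zero.2 hz)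
  have hzx : ‖z - a‖ = s * Real.exp (-x) := by
    rw [hx, neg_neg, Real.exp_log (by positivity)]; field_simp
  have hd : 0 < |x - y| := abs_pos.2 (sub_ne_zero.2 hxy)
  have h1 : |‖z - a‖ - ‖l - a‖| ≤ ‖z - l‖ := by
    have := abs_norm_sub_norm_le (z - a) (l - a)
    rwa [sub_sub_sub_cancel_right] at this
  have hpos : 0 < 1 - Real.exp (-|x - y|) := by
    have : Real.exp (-|x - y|) < 1 := Real.exp_lt_one_iff.2 (by linarith)
    linarith
  have h2 : s * Real.exp (-y) * (1 - Real.exp (-|x - y|)) ≤ |‖z - a‖ - ‖l - a‖| := by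
    rw [hzx, hl, ← mul_sub, abs_mul, abs_of_pos hs, mul_assoc]
    gcongr
    rcases le_total x y with h | h
    · rw [abs_of_nonpos (by linarith : x - y ≤ 0)]
      refine le_trans ?_ (le_abs_self _)
      have e : Real.exp (-x) - Real.exp (-y) = Real.exp (-x) * (1 - Real.exp (- -(x - y))) := by
        rw [mul_sub, ← Real.exp_add]; ring_nf
      rw [e]
      rw [abs_of_nonpos (by linarith : x - y ≤ 0)] at hpos
      gcongr
    · rw [abs_of_nonneg (by linarith : 0 ≤ x - y), abs_sub_comm]
      refine le_trans (le_of_eq ?_) (le_abs_self _)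
      rw [mul_sub, ← Real.exp_add]; ring_nf
  have h3 : Real.log (s * Real.exp (-y) * (1 - Real.exp (-|x - y|))) ≤ lk τ z l := by
    unfold lk
    exact Real.log_le_log (by positivity) ((h2.trans h1).trans (le_max_left _ _))
  rw [Real.log_mul (by positivity) hpos.ne', Real.log_mul hs.ne' (Real.exp_pos _).ne',
    Real.log_exp] at h3
  have := phi_bound hd
  linarith

lemma gauss (n : ℕ) : (n:ℝ) ^ 2 / 2 ≤ ∑ i ∈ Finset.range n, ((i:ℝ) + 1) := by
  induction n with
  | zero => simp
  | succ n ih =>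
    rw [Finset.sum_range_succ]
    push_cast
    nlinarith

set_option maxHeartbeats 1000000 in
lemma gfun {O : Set ℂ} (hO : IsOpen O) (hOc : IsConnected O) {a : ℂ}
    (hac : a ∈ closure O) {ε s : ℝ} (hε : 0 < ε) (hε1 : ε < 1) (hs : 0 < s)
    (hb : ∃ b ∈ O, s ≤ ‖b - a‖) :
    ∃ (L : Set ℂ) (g : ℂ → ℝ), IsCompact L ∧ L ⊆ O ∧ L ⊆ closedBall a (2 * s) ∧ Continuous g ∧
      (∀ z, g z ≤ -ε) ∧ (∀ z, 2 * s ≤ ‖z - a‖ → g z ≤ -1) ∧ -(2 * ε) ≤ g a ∧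
      ∀ z, z ∉ interior L → LSM g z := by
  obtain ⟨b, hbO, hbs⟩ := hb
  set X : ℝ := 32 / ε + 1 with hX
  have hX1 : 1 ≤ X := by rw [hX]; have : 0 < 32 / ε := by positivity
                         linarith
  have hX2 : 32 ≤ ε * X := by rw [hX, mul_add, mul_div_cancel₀ _ hε.ne']; linarith
  obtain ⟨p, hpO, hpa⟩ := Metric.mem_closure_iff.1 hac (s * Real.exp (-X)) (by positivity)
  have hpc : IsPathConnected O := hO.isConnected_iff_isPathConnected.1 hOc
  obtain ⟨γ, hγ⟩ := hpc.joinedIn p hpO b hbO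
  set Γ := range γ with hΓ
  have hΓc : IsCompact Γ := isCompact_range γ.continuous
  have hΓO : Γ ⊆ O := by rintro _ ⟨t, rfl⟩; exact hγ t
  have hΓp : IsPreconnected Γ := isPreconnected_range γ.continuous
  have hivt : ∀ y, 0 ≤ y → y ≤ X → ∃ l ∈ Γ, ‖l - a‖ = s * Real.exp (-y) := by
    intro y hy0 hyX
    have hcn : ContinuousOn (fun z : ℂ => ‖z - a‖) Γ := by fun_prop
    have := hΓp.intermediate_value (a := p) (b := b) ⟨0, γ.source⟩ ⟨1, γ.target⟩ hcn
    have hmem : s * Real.exp (-y) ∈ Icc ‖p - a‖ ‖b - a‖ := by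
      constructor
      · rw [dist_comm, dist_eq_norm] at hpa
        refine hpa.le.trans ?_
        gcongr
      · refine le_trans ?_ hbs
        have : Real.exp (-y) ≤ 1 := Real.exp_le_one_iff.2 (by linarith)
        nlinarith
    obtain ⟨l, hl, h⟩ := this hmem
    exact ⟨l, hl, h⟩
  obtain ⟨δ, hδ, hδO⟩ := hΓc.exists_cthickening_subset_open hO hΓO
  set τ := min (min (δ / 2) (s * Real.exp (-X))) (s / 2) with hτ
  have hτ0 : 0 < τ := by positivity
  have t1 : τ ≤ δ / 2 := (min_le_left _ _).trans (min_le_left _ _)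
  have t2 : τ ≤ s * Real.exp (-X) := (min_le_left _ _).trans (min_le_right _ _)
  have t3 : τ ≤ s / 2 := min_le_right _ _
  set T := Real.log s - Real.log τ with hT
  have hT0 : 0 ≤ T := by
    have := Real.log_le_log hτ0 (by linarith : τ ≤ s); linarith
  obtain ⟨n, hn⟩ := exists_nat_gt (8 * T / (ε * X) )
  have hn0 : 0 < n := by
    have : 0 ≤ 8 * T / (ε * X) := by positivity
    have : (0:ℝ) < n := by linarith
    exact_mod_cast this
  have hnR : (0:ℝ) < n := by exact_mod_cast hn0
  set η := X / n with hη
  have hη0 : 0 < η := by positivity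
  have hnη : n * η = X := by rw [hη]; field_simp
  have : ∀ i : ℕ, ∃ l : ℂ, i < n → l ∈ Γ ∧ ‖l - a‖ = s * Real.exp (-((i + 1) * η)) := by
    intro i
    by_cases hi : i < n
    · obtain ⟨l, h1, h2⟩ := hivt ((i + 1) * η) (by positivity) (by
        rw [← hnη]
        gcongr
        exact_mod_cast hi)
      exact ⟨l, fun _ => ⟨h1, h2⟩⟩
    · exact ⟨0, fun h => absurd h hi⟩
  choose l hl using this
  have hls : ∀ i < n, ‖l i - a‖ ≤ s := by
    intro i hi
    rw [(hl i hi).2]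
    have : Real.exp (-((i + 1) * η)) ≤ 1 := Real.exp_le_one_iff.2 (by
      have : 0 ≤ ((i:ℝ) + 1) * η := by positivity
      linarith)
    nlinarith
  set h : ℂ → ℝ := fun z => ∑ i ∈ Finset.range n, (Real.log s - lk τ z (l i)) with hh
  set S := ∑ i ∈ Finset.range n, ((i:ℝ) + 1) * η with hS
  have hha : h a = S := by
    refine Finset.sum_congr rfl fun i hi => ?_
    have hi' := Finset.mem_range.1 hi
    have e := (hl i hi').2
    have : τ ≤ ‖a - l i‖ := by
      rw [norm_sub_rev, e]
      refine t2.trans ?_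
      rw [← hnη]
      gcongr
      exact_mod_cast hi'
    unfold lk
    rw [max_eq_left this, norm_sub_rev, e, Real.log_mul hs.ne' (Real.exp_pos _).ne', Real.log_exp]
    ring
  have hSge : n * X / 2 ≤ S := by
    rw [hS, ← Finset.sum_mul]
    have := mul_le_mul_of_nonneg_right (gauss n) hη0.le
    refine le_trans (le_of_eq ?_) this
    rw [← hnη]; ring
  have hS0 : 0 < S := lt_of_lt_of_le (by positivity) hSge
  set H := S + (2 * T + 8 * (√(n:ℝ) / √η)) with hH
  have hE0 : 0 ≤ 2 * T + 8 * (√(n:ℝ) / √η) := by positivity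
  have hH0 : 0 < H := by linarith
  have hE : 2 * T + 8 * (√(n:ℝ) / √η) ≤ ε * S := by
    have e1 : √(n:ℝ) / √η = n / √X := by
      rw [hη, Real.sqrt_div' _ hnR.le]
      have := Real.mul_self_sqrt hnR.le
      have : 0 < √(n:ℝ) := Real.sqrt_pos.2 hnR
      have : 0 < √X := Real.sqrt_pos.2 (by linarith)
      field_simp
      rw [Real.sq_sqrt hnR.le]
    have e2 : n / √X ≤ n := by
      apply div_le_self hnR.le
      rw [Real.one_le_sqrt]; exact hX1
    have e3 : 8 * T < n * (ε * X) := by rwa [div_lt_iff₀ (by positivity)] at hn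
    have e4 : 32 * n ≤ n * (ε * X) := by nlinarith
    have e5 : ε * (n * X / 2) ≤ ε * S := by gcongr
    rw [e1]
    nlinarith
  have hhle : ∀ z, h z ≤ H := by
    intro z
    by_cases hza : z = a
    · rw [hza, hha]; linarith
    have hsum : h z = S + ∑ i ∈ Finset.range n, (Real.log s - lk τ z (l i) - (i + 1) * η) := by
      simp only [hh, hS]
      rw [← Finset.sum_add_distrib]
      exact Finset.sum_congr rfl fun i _ => by ring
    rw [hsum, hH]
    refine add_le_add le_rfl ?_
    apply excess (x := - Real.log (‖z - a‖ / s)) hη0 hT0 n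
    · intro i _
      have : Real.log τ ≤ lk τ z (l i) := Real.log_le_log hτ0 (le_max_right _ _)
      have : 0 ≤ ((i:ℝ) + 1) * η := by positivity
      linarith
    · intro i hi hne
      exact term_bound hs hτ0 (hl i hi).2 hza hne
  refine ⟨⋃ i ∈ Finset.range n, closedBall (l i) (2 * τ),
    fun z => -1 + (1 - ε) / H * h z, ?_, ?_, ?_, ?_, ?_, ?_, ?_, ?_⟩
  · exact (Finset.range n).isCompact_biUnion fun i _ => isCompact_closedBall _ _
  · refine iUnion₂_subset fun i hi => ?_
    refine Subset.trans ?_ hδO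
    refine (closedBall_subset_closedBall (by linarith)).trans
      (closedBall_subset_cthickening (hl i (Finset.mem_range.1 hi)).1 δ)
  · refine iUnion₂_subset fun i hi => ?_
    apply closedBall_subset_closedBall'
    rw [dist_eq_norm]
    linarith [hls i (Finset.mem_range.1 hi)]
  · have : Continuous h := continuous_finsetSum _ fun i _ =>
      continuous_const.sub (by
        unfold lk
        refine Continuous.log (by fun_prop) fun z => ?_
        exact (lt_of_lt_of_le hτ0 (le_max_right _ _)).ne')
    fun_prop
  · intro z
    have h1 : (1 - ε) / H * h z ≤ (1 - ε) / H * H := by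
      have : 0 ≤ (1 - ε) / H := div_nonneg (by linarith) hH0.le
      gcongr
      exact hhle z
    rw [div_mul_cancel₀ _ hH0.ne'] at h1
    linarith
  · intro z hz
    have h1 : h z ≤ 0 := by
      apply Finset.sum_nonpos
      intro i hi
      have h2 := hls i (Finset.mem_range.1 hi)
      have h3 : s ≤ ‖z - l i‖ := by
        have := norm_sub_norm_le (z - a) (l i - a)
        rw [sub_sub_sub_cancel_right] at this
        linarith
      unfold lk
      have := Real.log_le_log hs (h3.trans (le_max_left _ τ))
      linarith
    have : 0 ≤ (1 - ε) / H := div_nonneg (by linarith) hH0.le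
    have := mul_nonpos_of_nonneg_of_nonpos this h1
    linarith
  · simp only [hha]
    have h1 : H ≤ (1 + ε) * S := by rw [hH]; linarith
    have h2 : 1 - ε ≤ S / H := by
      rw [le_div_iff₀ hH0]
      have q1 := mul_le_mul_of_nonneg_left h1 (by linarith : 0 ≤ 1 - ε)
      have q2 : 0 ≤ ε ^ 2 * S := by positivity
      linarith
    have h3 : (1 - ε) / H * S = (1 - ε) * (S / H) := by ring
    rw [h3]
    have q3 := mul_le_mul_of_nonneg_left h2 (by linarith : 0 ≤ 1 - ε)
    have q4 := sq_nonneg ε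
    linarith
  · intro z hz
    refine (LSM.const (-1) z).add (LSM.const_mul ?_ (div_nonneg (by linarith) hH0.le))
    refine LSM.sum _ fun i hi => ?_
    have hzi : 2 * τ ≤ ‖z - l i‖ := by
      by_contra hcon
      push Not at hcon
      apply hz
      refine mem_interior.2 ⟨ball (l i) (2 * τ), ?_, isOpen_ball, by rwa [mem_ball, dist_eq_norm]⟩
      exact ball_subset_closedBall.trans (subset_biUnion_of_mem (u := fun i => closedBall (l i) (2 * τ)) hi)
    have hne : z - l i ≠ 0 := by
      rw [← norm_pos_iff]; linarith
    have := (LSM.const (Real.log s) z).add (LSM.neg_log_norm (h := fun z => z - l i) (p := z)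
      (Eventually.of_forall fun q => by fun_prop) hne)
    refine this.congr ?_
    have hlt : τ < ‖z - l i‖ := by linarith
    have hc : Continuous fun z : ℂ => ‖z - l i‖ := by fun_prop
    filter_upwards [(isOpen_lt continuous_const hc).mem_nhds hlt] with q hq
    unfold lk
    rw [max_eq_left (le_of_lt hq)]
    ring

end PH
end

section
open Set Metric MeasureTheory Filter Topology
namespace PH

lemma open_sdiff {D A : Set ℂ} (hD : IsOpen D)
    (hAclosed : ∀ z ∈ D, z ∈ closure A → z ∈ A) : IsOpen (D \ A) := by
  have : D \ A = D \ closure A := by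
    ext z
    exact ⟨fun h => ⟨h.1, fun h' => h.2 (hAclosed z h.1 h')⟩,
      fun h => ⟨h.1, fun h' => h.2 (subset_closure h')⟩⟩
  rw [this]
  exact hD.sdiff isClosed_closure

lemma exists_v1_aux {D A X Y L : Set ℂ} (hD : IsOpen D) (hAD : A ⊆ D)
    (hAclosed : ∀ z ∈ D, z ∈ closure A → z ∈ A) (hp : PolarSet A) {f : ℂ → ℂ}
    (hf : DifferentiableOn ℂ f (D \ A)) (hX : IsCompact X) (hXD : X ⊆ D) (hXA : (A ∩ X).Nonempty)
    (hY : IsCompact Y) (hYD : Y ⊆ D \ A) (hL : IsCompact L) (hLD : L ⊆ D \ A) :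
    ∃ C1 κ : ℝ, 0 ≤ C1 ∧ 0 ≤ κ ∧ ∀ M : ℝ, 2 < M → ∃ (Q P : ℂ → ℂ) (N : Set ℂ) (m : ℕ),
      0 < m ∧ IsOpen N ∧ X ⊆ N ∧ Differentiable ℂ Q ∧ (∀ z ∈ N, DifferentiableAt ℂ P z) ∧
      (∀ z ∈ X, ‖Q z‖ ≤ 1) ∧ (∀ z ∈ X, ‖P z‖ ≤ C1 + 1) ∧
      (∀ z ∈ Y ∪ L, ‖Q z * f z - P z‖ ≤ Real.exp (-((M - 2) * m)) / 2) ∧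
      (∀ z ∈ L, Real.exp (-(κ * m)) ≤ ‖Q z‖) := by
  have hDA := open_sdiff hD hAclosed
  have hfd : ∀ z ∈ D \ A, DifferentiableAt ℂ f z := fun z hz =>
    hf.differentiableAt (hDA.mem_nhds hz)
  obtain ⟨W0, hW0, hAXW, hW0D, hA'c, hW0b⟩ := good_cover hD hAD hAclosed hp hX hXD
  set A' := A ∩ W0 with hA'
  have hA'p : PolarSet A' := polar_mono hp inter_subset_left
  have hA'n : A'.Nonempty := by
    obtain ⟨z, hz⟩ := hXA
    exact ⟨z, hz.1, hAXW hz⟩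
  obtain ⟨W1, hW1, hA'W1, hW1cl, hW1c⟩ := exists_open_between_and_isCompact_closure hA'c hW0
    inter_subset_right
  -- bound for f
  have hcpt : IsCompact ((X \ W1) ∪ frontier W1) := by
    refine (hX.diff hW1).union (hW1c.of_isClosed_subset isClosed_frontier frontier_subset_closure)
  have hcptD : (X \ W1) ∪ frontier W1 ⊆ D \ A := by
    rintro z (hz | hz)
    · exact ⟨hXD hz.1, fun h => hz.2 (hA'W1 ⟨h, hAXW ⟨h, hz.1⟩⟩)⟩
    · have hzW0 : z ∈ W0 := hW1cl (frontier_subset_closure hz)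
      refine ⟨hW0D hzW0, fun h => ?_⟩
      have := hA'W1 ⟨h, hzW0⟩
      exact hz.2 (by rwa [hW1.interior_eq])
  obtain ⟨c1, hc1⟩ := hcpt.exists_bound_of_continuousOn (hf.continuousOn.mono hcptD)
  -- radius
  obtain ⟨ρ, hρ1, hρ⟩ : ∃ ρ : ℝ, 1 ≤ ρ ∧ ∀ z ∈ X ∪ W0, ∀ a ∈ A', ‖z - a‖ ≤ ρ := by
    have hbd : Bornology.IsBounded ((X ∪ W0) ∪ A') := (hX.isBounded.union hW0b).union hA'c.isBounded
    obtain ⟨C, hC⟩ := hbd.exists_norm_le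
    refine ⟨max 1 (C + C), le_max_left _ _, fun z hz a ha => ?_⟩
    exact (norm_sub_le _ _).trans
      ((add_le_add (hC z (Or.inl hz)) (hC a (Or.inr ha))).trans (le_max_right _ _))
  have hρ0 : 0 < ρ := by linarith
  obtain ⟨d, hd0, hd⟩ : ∃ d : ℝ, 0 < d ∧ ∀ z ∈ L, ∀ a ∈ A', d ≤ ‖z - a‖ := by
    have hdis : Disjoint L A' := by
      rw [Set.disjoint_left]; exact fun z hz h => (hLD hz).2 h.1
    obtain ⟨d, hd0, hd⟩ := hdis.exists_thickenings hL hA'c.isClosed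
    refine ⟨d, hd0, fun z hz a ha => ?_⟩
    by_contra hcon
    push Not at hcon
    rw [Set.disjoint_left] at hd
    refine hd (a := a) ?_ (self_subset_thickening hd0 _ ha)
    rw [mem_thickening_iff]
    exact ⟨z, hz, by rwa [dist_comm, dist_eq_norm]⟩
  set κ := |Real.log (d / ρ)| with hκ
  have hκe : Real.exp (-κ) ≤ d / ρ := by
    rw [← Real.exp_log (show 0 < d / ρ by positivity), Real.exp_le_exp]
    exact neg_le.1 (neg_le_abs _)
  refine ⟨|c1|, κ, abs_nonneg _, abs_nonneg _, fun M hM => ?_⟩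
  obtain ⟨n, a, hn, ha, hQA⟩ := cheb hA'c hA'n hA'p M
  set Q0 : ℂ → ℂ := fun z => ∏ i, ((z - a i) / ρ) with hQ0
  have hQ0n : ∀ z, ‖Q0 z‖ = ∏ i, (‖z - a i‖ / ρ) := by
    intro z
    simp only [hQ0, norm_prod, norm_div, Complex.norm_real, Real.norm_eq_abs, abs_of_pos hρ0]
  have hQ0d : Differentiable ℂ Q0 := fun z => by
    apply DifferentiableAt.fun_finsetProd
    intro i _
    fun_prop
  have hQ01 : ∀ z ∈ X ∪ W0, ‖Q0 z‖ ≤ 1 := by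
    intro z hz
    rw [hQ0n]
    apply Finset.prod_le_one
    · intro i _; positivity
    · intro i _
      rw [div_le_one hρ0]
      exact hρ z hz _ (ha i)
  have hQ0A : ∀ z ∈ A', ‖Q0 z‖ < Real.exp (-((M - 1) * n)) := by
    intro z hz
    have h1 : ‖Q0 z‖ ≤ ∏ i, ‖z - a i‖ := by
      rw [hQ0n]
      apply Finset.prod_le_prod
      · intro i _; positivity
      · intro i _; exact div_le_self (norm_nonneg _) hρ1
    refine (h1.trans (hQA z hz)).trans_lt ?_
    rw [Real.exp_lt_exp]
    have : (0:ℝ) < n := by exact_mod_cast hn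
    nlinarith
  have hQ0L : ∀ z ∈ L, Real.exp (-(κ * n)) ≤ ‖Q0 z‖ := by
    intro z hz
    have h1 : ∏ i : Fin n, Real.exp (-κ) ≤ ∏ i, (‖z - a i‖ / ρ) := by
      apply Finset.prod_le_prod
      · intro i _; positivity
      · intro i _
        refine hκe.trans ?_
        have := hd z hz _ (ha i)
        gcongr
    rw [Finset.prod_const, Finset.card_univ, Fintype.card_fin, ← Real.exp_nat_mul] at h1
    rw [hQ0n]
    convert h1 using 2
    ring
  -- the thin neighbourhood W
  set W := W1 ∩ (Y ∪ L)ᶜ ∩ {z | ‖Q0 z‖ < Real.exp (-((M - 1) * n))} with hW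
  have hWo : IsOpen W := (hW1.inter (hY.union hL).isClosed.isOpen_compl).inter
    (isOpen_lt hQ0d.continuous.norm continuous_const)
  have hA'W : A' ⊆ W := by
    intro z hz
    refine ⟨⟨hA'W1 hz, ?_⟩, hQ0A z hz⟩
    rintro (h | h)
    · exact (hYD h).2 hz.1
    · exact (hLD h).2 hz.1
  have hWW0 : W ⊆ W0 := fun z hz => hW1cl (subset_closure hz.1.1)
  obtain ⟨C, hC, Z, hZ, hZW, hsplit⟩ := split hWo hA'c hA'p hA'W
  have hZD : Z ⊆ D \ A := fun z hz => ⟨hW0D (hWW0 (hZW hz).1),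
    fun h => (hZW hz).2 ⟨h, hWW0 (hZW hz).1⟩⟩
  obtain ⟨bf, hbf⟩ := hZ.exists_bound_of_continuousOn (hf.continuousOn.mono hZD)
  -- choice of the power
  obtain ⟨l, hl⟩ := exists_nat_gt (2 * (C * |bf|))
  have hexpl : C * |bf| * Real.exp (-((M - 1) * n)) ^ (l + 1) ≤
      Real.exp (-((M - 2) * ((n * (l + 1) : ℕ) : ℝ))) / 2 := by
    have e1 : Real.exp (-((M - 1) * n)) ^ (l + 1) =
        Real.exp (-((M - 2) * ((n * (l + 1) : ℕ) : ℝ))) * Real.exp (-((n * (l + 1) : ℕ) : ℝ)) := by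
      rw [← Real.exp_nat_mul, ← Real.exp_add]
      congr 1
      push_cast
      ring
    have e2 : C * |bf| * Real.exp (-((n * (l + 1) : ℕ) : ℝ)) ≤ 1 / 2 := by
      rw [Real.exp_neg, ← div_eq_mul_inv, div_le_iff₀ (Real.exp_pos _)]
      have h1 := Real.add_one_le_exp ((n * (l + 1) : ℕ) : ℝ)
      have h2 : (l:ℝ) ≤ ((n * (l + 1) : ℕ) : ℝ) := by
        exact_mod_cast (Nat.le_succ l).trans (Nat.le_mul_of_pos_left _ hn)
      linarith
    rw [e1]
    have := mul_le_mul_of_nonneg_left e2 (Real.exp_pos (-((M - 2) * ((n * (l + 1) : ℕ) : ℝ)))).le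
    linarith
  set g : ℂ → ℂ := fun z => Q0 z ^ (l + 1) * f z with hg
  have hWA : ∀ z ∈ W, z ∉ A' → z ∉ A := fun z hz h h' => h ⟨h', hWW0 hz⟩
  obtain ⟨F, G, hF, hG, hFG, hFb⟩ := hsplit g (Real.exp (-((M - 1) * n)) ^ (l + 1) * |bf|)
    (by positivity)
    (fun z hz => (((hQ0d z).pow (l + 1)).mul (hfd z ⟨hW0D (hWW0 hz.1),
      hWA z hz.1 hz.2⟩)).differentiableWithinAt)
    (fun z hz => by
      simp only [hg, norm_mul, norm_pow]
      have h1 : ‖Q0 z‖ < Real.exp (-((M - 1) * n)) := (hZW hz).1.2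
      have h2 := (hbf z hz).trans (le_abs_self _)
      gcongr)
  have hFe : ∀ z, z ∉ W → ‖F z‖ ≤ Real.exp (-((M - 2) * ((n * (l + 1) : ℕ) : ℝ))) / 2 := by
    intro z hz
    refine (hFb z hz).trans (le_trans (le_of_eq ?_) hexpl)
    ring
  have hFe1 : ∀ z, z ∉ W → ‖F z‖ ≤ 1 := by
    intro z hz
    refine (hFe z hz).trans ?_
    have : Real.exp (-((M - 2) * ((n * (l + 1) : ℕ) : ℝ))) ≤ 1 := by
      rw [Real.exp_le_one_iff]
      have h1 : (0:ℝ) ≤ ((n * (l + 1) : ℕ) : ℝ) := Nat.cast_nonneg _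
      have h2 : 0 ≤ M - 2 := by linarith
      have := mul_nonneg h2 h1
      linarith
    linarith
  classical
  set P : ℂ → ℂ := fun z => if z ∈ A then G z else g z - F z with hP
  have hPnA : ∀ z, z ∉ A → P z = g z - F z := fun z hz => if_neg hz
  have hPW : ∀ z ∈ W, P z = G z := by
    intro z hz
    simp only [hP]
    split_ifs with h
    · rfl
    · rw [hFG z ⟨hz, fun h' => h h'.1⟩]; ring
  have hPd : ∀ z ∈ (D \ A) ∪ W, DifferentiableAt ℂ P z := by
    rintro z (hz | hz)
    · have h1 : DifferentiableAt ℂ (fun z => g z - F z) z :=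
        (((hQ0d z).pow (l + 1)).mul (hfd z hz)).sub (hF z fun h => hz.2 h.1)
      refine h1.congr_of_eventuallyEq ?_
      filter_upwards [hDA.mem_nhds hz] with y hy
      exact hPnA y hy.2
    · refine (hG.differentiableAt (hWo.mem_nhds hz)).congr_of_eventuallyEq ?_
      filter_upwards [hWo.mem_nhds hz] with y hy
      exact hPW y hy
  have hXN : X ⊆ (D \ A) ∪ W := by
    intro z hz
    by_cases h : z ∈ A
    · exact Or.inr (hA'W ⟨h, hAXW ⟨h, hz⟩⟩)
    · exact Or.inl ⟨hXD hz, h⟩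
  have hW0N : W0 ⊆ (D \ A) ∪ W := by
    intro z hz
    by_cases h : z ∈ A
    · exact Or.inr (hA'W ⟨h, hz⟩)
    · exact Or.inl ⟨hW0D hz, h⟩
  have hPb1 : ∀ z ∈ (X \ W1) ∪ frontier W1, ‖P z‖ ≤ |c1| + 1 := by
    intro z hz
    have hzD := hcptD hz
    have hzW1 : z ∉ W1 := by
      rcases hz with hz | hz
      · exact hz.2
      · intro h; exact hz.2 (by rwa [hW1.interior_eq])
    have hzX : z ∈ X ∪ W0 := by
      rcases hz with hz | hz
      · exact Or.inl hz.1
      · exact Or.inr (hW1cl (frontier_subset_closure hz))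
    rw [hPnA z hzD.2]
    refine (norm_sub_le _ _).trans (add_le_add ?_ (hFe1 z fun h => hzW1 h.1.1))
    simp only [hg, norm_mul, norm_pow]
    have h1 : ‖Q0 z‖ ^ (l + 1) ≤ 1 := pow_le_one₀ (norm_nonneg _) (hQ01 z hzX)
    have h2 := (hc1 z hz).trans (le_abs_self _)
    calc ‖Q0 z‖ ^ (l + 1) * ‖f z‖ ≤ 1 * |c1| := by gcongr
      _ = |c1| := one_mul _
  refine ⟨fun z => Q0 z ^ (l + 1), P, (D \ A) ∪ W, n * (l + 1), by positivity, hDA.union hWo, hXN,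
    fun z => (hQ0d z).pow (l + 1), hPd, ?_, ?_, ?_, ?_⟩
  · intro z hz
    simp only [norm_pow]
    exact pow_le_one₀ (norm_nonneg _) (hQ01 z (Or.inl hz))
  · intro z hz
    by_cases h : z ∈ W1
    · refine Complex.norm_le_of_forall_mem_frontier_norm_le (U := W1)
        (hW1c.isBounded.subset subset_closure) ?_ (fun y hy => hPb1 y (Or.inr hy)) (subset_closure h)
      exact DifferentiableOn.diffContOnCl fun y hy =>
        (hPd y (hW0N (hW1cl hy))).differentiableWithinAt
    · exact hPb1 z (Or.inl ⟨hz, h⟩)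
  · intro z hz
    have hzA : z ∉ A := by
      rcases hz with hz | hz
      · exact (hYD hz).2
      · exact (hLD hz).2
    rw [hPnA z hzA]
    simp only [hg, sub_sub_cancel]
    exact hFe z fun h => h.1.2 hz
  · intro z hz
    simp only [norm_pow]
    have h1 := pow_le_pow_left₀ (Real.exp_pos _).le (hQ0L z hz) (l + 1)
    rw [← Real.exp_nat_mul] at h1
    refine le_trans (le_of_eq ?_) h1
    congr 1
    push_cast
    ring

lemma exists_v1 {D A X Y L : Set ℂ} (hD : IsOpen D) (hAD : A ⊆ D)
    (hAclosed : ∀ z ∈ D, z ∈ closure A → z ∈ A) (hp : PolarSet A) {f : ℂ → ℂ}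
    (hf : DifferentiableOn ℂ f (D \ A)) (hX : IsCompact X) (hXD : X ⊆ D) (hXA : (A ∩ X).Nonempty)
    (hY : IsCompact Y) (hYD : Y ⊆ D \ A) (hL : IsCompact L) (hLD : L ⊆ D \ A)
    {R ε : ℝ} (hR : 0 ≤ R) (hε : 0 < ε) (hfL : ∀ z ∈ L, R + 1 ≤ ‖f z‖) :
    ∃ v : ℂ × ℂ → ℝ, (∀ p : ℂ × ℂ, p.1 ∈ X → LSM v p) ∧
      (∀ p : ℂ × ℂ, p.1 ∈ X → ‖p.2‖ ≤ R → v p ≤ 0) ∧ (∀ p, -1 ≤ v p) ∧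
      (∀ z ∈ Y, v (z, f z) ≤ -1) ∧ (∀ p : ℂ × ℂ, p.1 ∈ L → ‖p.2‖ ≤ R → -ε ≤ v p) := by
  obtain ⟨C1, κ, hC1, hκ, hM⟩ := exists_v1_aux hD hAD hAclosed hp hf hX hXD hXA hY hYD hL hLD
  set C2 := R + (C1 + 1) with hC2
  have hC21 : 1 ≤ C2 := by linarith
  have hC20 : 0 < C2 := by linarith
  have hlog : 0 ≤ Real.log (2 * C2) := Real.log_nonneg (by linarith)
  set E := (κ + Real.log (2 * C2)) / ε + κ + 1 with hE
  have hq : 0 ≤ (κ + Real.log (2 * C2)) / ε := by positivity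
  have hE0 : 0 < E := by linarith
  obtain ⟨Q, P, N, m, hm, hN, hXN, hQ, hP, hQ1, hP1, hF, hQL⟩ := hM (E + 2) (by linarith)
  have hmR : (1:ℝ) ≤ m := by exact_mod_cast hm
  simp only [add_sub_cancel_right] at hF
  set S := E * m with hS
  have hS0 : 0 < S := by positivity
  set h : ℂ × ℂ → ℂ := fun p => (Q p.1 * p.2 - P p.1) / C2 with hh
  have hhn : ∀ p, ‖h p‖ = ‖Q p.1 * p.2 - P p.1‖ / C2 := fun p => by
    simp [hh, abs_of_pos hC20]
  have hmp : ∀ p, 0 < max ‖h p‖ (Real.exp (-S)) := fun p =>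
    lt_of_lt_of_le (Real.exp_pos _) (le_max_right _ _)
  refine ⟨fun p => S⁻¹ * Real.log (max ‖h p‖ (Real.exp (-S))), ?_, ?_, ?_, ?_, ?_⟩
  · intro p hpX
    refine LSM.const_mul (LSM.log_max ?_ (Real.exp_pos _)) (by positivity)
    have : {q : ℂ × ℂ | q.1 ∈ N} ∈ 𝓝 p := (hN.preimage continuous_fst).mem_nhds (hXN hpX)
    filter_upwards [this] with q hq
    have h1 : DifferentiableAt ℂ (fun p : ℂ × ℂ => Q p.1) q := (hQ q.1).comp q differentiableAt_fst
    have h2 : DifferentiableAt ℂ (fun p : ℂ × ℂ => P p.1) q := (hP q.1 hq).comp q differentiableAt_fst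
    have h3 : DifferentiableAt ℂ (fun p : ℂ × ℂ => p.2) q := differentiableAt_snd
    simp only [hh, div_eq_mul_inv]
    exact ((h1.fun_mul h3).fun_sub h2).mul_const _
  · intro p hpX hpR
    apply mul_nonpos_of_nonneg_of_nonpos (by positivity)
    apply Real.log_nonpos (hmp p).le
    apply max_le
    · rw [hhn, div_le_one hC20, hC2]
      refine (norm_sub_le _ _).trans (add_le_add ?_ (hP1 _ hpX))
      rw [norm_mul]
      calc ‖Q p.1‖ * ‖p.2‖ ≤ 1 * R := by
            have := hQ1 _ hpX
            gcongr
        _ = R := one_mul _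
    · rw [Real.exp_le_one_iff]; linarith
  · intro p
    have h1 : -S ≤ Real.log (max ‖h p‖ (Real.exp (-S))) := by
      rw [Real.le_log_iff_exp_le (hmp p)]
      exact le_max_right _ _
    calc (-1:ℝ) = S⁻¹ * (-S) := by field_simp
      _ ≤ _ := mul_le_mul_of_nonneg_left h1 (by positivity)
  · intro z hz
    have h1 : max ‖h (z, f z)‖ (Real.exp (-S)) = Real.exp (-S) := by
      apply max_eq_right
      rw [hhn]
      have := hF z (Or.inl hz)
      have h2 := Real.exp_pos (-S)
      exact (div_le_self (norm_nonneg _) hC21).trans (by linarith)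
    simp only [h1, Real.log_exp]
    apply le_of_eq
    field_simp
  · intro p hpL hpR
    have h1 := hF _ (Or.inr hpL)
    have h2 := hQL _ hpL
    have h3 := hfL _ hpL
    have hle : Real.exp (-S) ≤ Real.exp (-(κ * m)) := by
      rw [Real.exp_le_exp, hS]
      have : κ * m ≤ E * m := by gcongr; linarith
      linarith
    have h4 : ‖Q p.1‖ * 1 ≤ ‖Q p.1 * (p.2 - f p.1)‖ := by
      rw [norm_mul]
      gcongr
      have := norm_sub_norm_le (f p.1) p.2
      rw [norm_sub_rev] at this
      linarith
    have h5 : Real.exp (-(κ * m)) / 2 ≤ ‖Q p.1 * p.2 - P p.1‖ := by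
      have e : Q p.1 * (p.2 - f p.1) = (Q p.1 * p.2 - P p.1) - (Q p.1 * f p.1 - P p.1) := by ring
      rw [e] at h4
      have := norm_sub_le (Q p.1 * p.2 - P p.1) (Q p.1 * f p.1 - P p.1)
      linarith
    have h6 : Real.exp (-(κ * m)) / (2 * C2) ≤ max ‖h p‖ (Real.exp (-S)) := by
      refine le_trans ?_ (le_max_left _ _)
      rw [hhn, ← div_div]
      gcongr
    have h7 := Real.log_le_log (by positivity) h6
    rw [Real.log_div (Real.exp_pos _).ne' (by positivity), Real.log_exp] at h7
    have h8 : -(ε * S) ≤ -(κ * m) - Real.log (2 * C2) := by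
      have e1 : κ + Real.log (2 * C2) ≤ ε * E := by
        have : ε * ((κ + Real.log (2 * C2)) / ε) = κ + Real.log (2 * C2) := by field_simp
        have e2 : ε * ((κ + Real.log (2 * C2)) / ε) ≤ ε * E := by
          gcongr; linarith
        linarith
      have e3 := mul_le_mul_of_nonneg_right e1 (by linarith : (0:ℝ) ≤ m)
      have e4 : Real.log (2 * C2) ≤ Real.log (2 * C2) * m := le_mul_of_one_le_right hlog hmR
      rw [hS]
      linarith
    calc -ε = S⁻¹ * (-(ε * S)) := by field_simp
      _ ≤ _ := mul_le_mul_of_nonneg_left (h8.trans h7) (by positivity)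

end PH
end

section
open Set Metric MeasureTheory Filter Topology
namespace PH

/-- inverse distance to the boundary -/
noncomputable def idist (D : Set ℂ) (z : ℂ) : ℝ := (infDist z Dᶜ)⁻¹

lemma idist_nonneg (D : Set ℂ) (z : ℂ) : 0 ≤ idist D z := inv_nonneg.2 infDist_nonneg

lemma idist_cont {D : Set ℂ} (hD : IsOpen D) {z : ℂ} (hz : z ∈ D) : ContinuousAt (idist D) z := by
  rcases (Dᶜ).eq_empty_or_nonempty with h | h
  · have : idist D = fun _ => 0 := by
      funext x; simp [idist, h]
    rw [this]; exact continuousAt_const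
  · refine ContinuousAt.inv₀ (continuous_infDist_pt _).continuousAt ?_
    have := (hD.isClosed_compl.notMem_iff_infDist_pos h).1 (fun h : z ∈ Dᶜ => h hz)
    exact this.ne'

lemma idist_lsm {D : Set ℂ} (hD : IsOpen D) {z : ℂ} (hz : z ∈ D) : LSM (idist D) z := by
  have hc : ∀ᶠ q in 𝓝 z, ContinuousAt (idist D) q := by
    filter_upwards [hD.mem_nhds hz] with q hq using idist_cont hD hq
  rcases (Dᶜ).eq_empty_or_nonempty with h | h
  · have : idist D = fun _ => 0 := by
      funext x; simp [idist, h]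
    rw [this]; exact LSM.const _ _
  · obtain ⟨ζ, hζ, hζd⟩ := hD.isClosed_compl.exists_infDist_eq_dist h z
    have hne : ∀ q ∈ D, q - ζ ≠ 0 := fun q hq h0 => hζ (by rwa [← sub_eq_zero.1 h0])
    refine LSM.of_minorant (m := fun q => ‖(q - ζ)⁻¹‖) (LSM.norm ?_) ?_ ?_ hc
    · filter_upwards [hD.mem_nhds hz] with q hq
      exact DifferentiableAt.inv (differentiableAt_id.sub_const ζ) (hne q hq)
    · simp only [norm_inv, idist, hζd, dist_eq_norm]
    · filter_upwards [hD.mem_nhds hz] with q hq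
      rw [norm_inv, idist]
      have h1 := (hD.isClosed_compl.notMem_iff_infDist_pos h).1 (fun h : q ∈ Dᶜ => h hq)
      have h2 := infDist_le_dist_of_mem (x := q) hζ
      rw [dist_eq_norm] at h2
      exact inv_anti₀ h1 h2

/-- exhaustion function -/
noncomputable def rho (D : Set ℂ) (p : ℂ × ℂ) : ℝ := max (max ‖p.1‖ ‖p.2‖) (idist D p.1)

lemma rho_lsm {D : Set ℂ} (hD : IsOpen D) {p : ℂ × ℂ} (hp : p.1 ∈ D) : LSM (rho D) p := by
  refine LSM.max (LSM.max (LSM.norm ?_) (LSM.norm ?_)) (LSM.comp_fst (idist_lsm hD hp))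
  · exact Eventually.of_forall fun q => differentiableAt_fst
  · exact Eventually.of_forall fun q => differentiableAt_snd

lemma rho_cont {D : Set ℂ} (hD : IsOpen D) {p : ℂ × ℂ} (hp : p.1 ∈ D) : ContinuousAt (rho D) p :=
  (rho_lsm hD hp).1.self_of_nhds

/-- exhaustion by compact sets -/
def XX (D : Set ℂ) (r : ℝ) : Set ℂ := {z | z ∈ D ∧ ‖z‖ ≤ r ∧ idist D z ≤ r}

lemma XX_compact {D : Set ℂ} (hD : IsOpen D) {r : ℝ} (hr : 0 < r) : IsCompact (XX D r) := by
  have e : XX D r = closedBall 0 r ∩ {z | z ∈ D ∧ idist D z ≤ r} := by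
    ext z; simp [XX]; tauto
  rw [e]
  apply (isCompact_closedBall _ _).inter_right
  rcases (Dᶜ).eq_empty_or_nonempty with h | h
  · have hDu : D = univ := compl_empty_iff.1 h
    have : {z | z ∈ D ∧ idist D z ≤ r} = univ := by
      ext x; simp [idist, hDu, hr.le]
    rw [this]; exact isClosed_univ
  · have : {z | z ∈ D ∧ idist D z ≤ r} = {z | r⁻¹ ≤ infDist z Dᶜ} := by
      ext z
      simp only [mem_ofPred_eq, idist]
      constructor
      · rintro ⟨hz, hi⟩
        have h1 := (hD.isClosed_compl.notMem_iff_infDist_pos h).1 (fun h : z ∈ Dᶜ => h hz)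
        exact (inv_le_comm₀ h1 hr).1 hi
      · intro hz
        have h1 : 0 < infDist z Dᶜ := (inv_pos.2 hr).trans_le hz
        have := (hD.isClosed_compl.notMem_iff_infDist_pos h).2 h1
        exact ⟨not_not.1 this, (inv_le_comm₀ h1 hr).2 hz⟩
    rw [this]
    exact isClosed_le continuous_const (continuous_infDist_pt _)

lemma exists_vk {D A : Set ℂ} (hD : IsOpen D) (hAD : A ⊆ D)
    (hAclosed : ∀ z ∈ D, z ∈ closure A → z ∈ A) (hp : PolarSet A) {f : ℂ → ℂ}
    (hf : DifferentiableOn ℂ f (D \ A)) {a : ℂ} (ha : a ∈ A) (hG : Good D A f a) (k : ℕ) :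
    ∃ v : ℂ × ℂ → ℝ, (∀ p : ℂ × ℂ, p.1 ∈ D → LSM v p) ∧
      (∀ p : ℂ × ℂ, p.1 ∈ D → rho D p ≤ k → v p ≤ 0) ∧
      (∀ w, -(1 / 2) ^ k ≤ v (a, w)) ∧
      (∀ z ∈ D \ A, rho D (a, 0) ≤ k → rho D (z, f z) ≤ k - 1 → 1 / ((k:ℝ) + 1) ≤ infDist z A →
        v (z, f z) ≤ -1) := by
  set r : ℝ := (k:ℝ) + 1 with hr
  have hr0 : 0 < r := by positivity
  set ε : ℝ := (1 / 2) ^ (k + 1) with hε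
  have hε0 : 0 < ε := by positivity
  have hε1 : ε < 1 := pow_lt_one₀ (by norm_num) (by norm_num) (by omega)
  have h2ε : 2 * ε = (1 / 2) ^ k := by rw [hε, pow_succ]; ring
  set X := XX D r with hX
  have hXc : IsCompact X := XX_compact hD hr0
  have hXD : X ⊆ D := fun z hz => hz.1
  -- the function v2
  obtain ⟨v2, h21, h22, h23, h24⟩ : ∃ v : ℂ × ℂ → ℝ,
      (∀ p : ℂ × ℂ, p.1 ∈ X → ‖p.2‖ < r → LSM v p) ∧
      (∀ p : ℂ × ℂ, p.1 ∈ X → ‖p.2‖ ≤ r → v p ≤ 0) ∧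
      (∀ w, -(2 * ε) ≤ v (a, w)) ∧
      (a ∈ X → ∀ z ∈ X, 1 / r ≤ infDist z A → v (z, f z) ≤ -1) := by
    by_cases hXA : (A ∩ X).Nonempty
    · obtain ⟨O, hO, hOc, hOD, hOf, haO⟩ := hG (r + 1)
      obtain ⟨b, hb⟩ := hOc.nonempty
      have hba : 0 < ‖b - a‖ := by
        rw [norm_pos_iff, sub_ne_zero]
        rintro rfl
        exact (hOD hb).2 ha
      set s := min (1 / (2 * r)) ‖b - a‖ with hs
      have hs0 : 0 < s := lt_min (by positivity) hba
      have hs2 : 2 * s ≤ 1 / r := by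
        have : s ≤ 1 / (2 * r) := min_le_left _ _
        have e : 1 / r = 2 * (1 / (2 * r)) := by field_simp
        linarith
      obtain ⟨L, g, hL, hLO, -, hgc, hg1, hg2, hg3, hg4⟩ :=
        gfun hO hOc haO hε0 hε1 hs0 ⟨b, hb, min_le_right _ _⟩
      set Y := X ∩ {z | 1 / r ≤ infDist z A} with hY
      have hYc : IsCompact Y :=
        hXc.inter_right (isClosed_le continuous_const (continuous_infDist_pt _))
      have hYD : Y ⊆ D \ A := by
        rintro z ⟨hz1, hz2⟩
        refine ⟨hXD hz1, fun hzA => ?_⟩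
        have : 1 / r ≤ infDist z A := hz2
        rw [infDist_zero_of_mem hzA] at this
        have : 0 < 1 / r := by positivity
        linarith
      obtain ⟨v1, h1, h2, h3, h4, h5⟩ := exists_v1 hD hAD hAclosed hp hf hXc hXD hXA hYc hYD hL
        (hLO.trans hOD) hr0.le hε0 (fun z hz => (hOf z (hLO hz)).le)
      refine ⟨fun p => max (v1 p) (g p.1), ?_, ?_, ?_, ?_⟩
      · intro p hpX hpr
        by_cases hpL : p.1 ∈ interior L
        · refine LSM.congr (h1 p hpX) ?_
          have e1 : ∀ᶠ q : ℂ × ℂ in 𝓝 p, q.1 ∈ interior L :=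
            (isOpen_interior.preimage continuous_fst).mem_nhds hpL
          have e2 : ∀ᶠ q : ℂ × ℂ in 𝓝 p, ‖q.2‖ < r :=
            (continuous_snd.norm.continuousAt).eventually_lt_const hpr
          filter_upwards [e1, e2] with q hq1 hq2
          exact max_eq_left ((hg1 _).trans (h5 q (interior_subset hq1) hq2.le))
        · exact LSM.max (h1 p hpX) (LSM.comp_fst (hg4 _ hpL))
      · intro p hpX hpr
        exact max_le (h2 p hpX hpr) ((hg1 _).trans (by linarith))
      · intro w
        exact hg3.trans (le_max_right _ _)
      · intro haX z hz hzA
        refine max_le (h4 z ⟨hz, hzA⟩) (hg2 z (hs2.trans (hzA.trans ?_)))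
        rw [← dist_eq_norm]
        exact infDist_le_dist_of_mem ha
    · refine ⟨fun _ => 0, fun p _ _ => LSM.const _ _, fun _ _ _ => le_rfl, fun _ => by linarith, ?_⟩
      intro haX
      exact absurd ⟨a, ha, haX⟩ hXA
  have hrX : ∀ p : ℂ × ℂ, p.1 ∈ D → rho D p ≤ r → p.1 ∈ X ∧ ‖p.2‖ ≤ r := by
    intro p hpD hpr
    have h1 := max_le_iff.1 hpr
    have h2 := max_le_iff.1 h1.1
    exact ⟨⟨hpD, h2.1, h1.2⟩, h2.2⟩
  have hrs : ∀ p : ℂ × ℂ, ‖p.2‖ ≤ rho D p := fun p => (le_max_right _ _).trans (le_max_left _ _)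
  have hDn : ∀ p : ℂ × ℂ, p.1 ∈ D → ∀ᶠ q : ℂ × ℂ in 𝓝 p, q.1 ∈ D := fun p hp =>
    (hD.preimage continuous_fst).mem_nhds hp
  have hrl : ∀ p : ℂ × ℂ, p.1 ∈ D → LSM (fun q => rho D q - k) p := fun p hp => by
    simpa [sub_eq_add_neg] using (rho_lsm hD hp).add (LSM.const (-(k:ℝ)) p)
  classical
  refine ⟨fun p => if rho D p < r then max (v2 p) (rho D p - k) else rho D p - k, ?_, ?_, ?_, ?_⟩
  · intro p hpD
    rcases lt_or_ge (rho D p) r with h | h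
    · have hX1 := hrX p hpD h.le
      refine LSM.congr (LSM.max (h21 p hX1.1 ((hrs p).trans_lt h)) (hrl p hpD)) ?_
      filter_upwards [(rho_cont hD hpD).eventually_lt_const h] with q hq
      simp [hq]
    · refine LSM.congr (hrl p hpD) ?_
      have hk : (k:ℝ) < rho D p := by linarith
      filter_upwards [(rho_cont hD hpD).eventually_const_lt hk, hDn p hpD] with q hq hqD
      by_cases hq2 : rho D q < r
      · have hX1 := hrX q hqD hq2.le
        simp only [hq2, if_true]
        exact max_eq_right ((h22 q hX1.1 hX1.2).trans (by linarith))
      · simp [hq2]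
  · intro p hpD hpk
    have h : rho D p < r := by linarith
    have hX1 := hrX p hpD h.le
    simp only [h, if_true]
    exact max_le (h22 p hX1.1 hX1.2) (by linarith)
  · intro w
    have := h23 w
    by_cases h : rho D (a, w) < r
    · simp only [h, if_true]
      rw [← h2ε]
      exact this.trans (le_max_left _ _)
    · simp only [h, if_false]
      linarith
  · intro z hz hak hzk hzA
    have h : rho D (z, f z) < r := by linarith
    have hX1 := hrX (z, f z) hz.1 h.le
    have hX2 := hrX (a, 0) (hAD ha) (by linarith)
    simp only [h, if_true]
    exact max_le (h24 hX2.1 z hX1.1 hzA) (by linarith)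

end PH
end

section
open Set Metric MeasureTheory Filter Topology
namespace PH

theorem final (D A : Set ℂ) (f : ℂ → ℂ)
    (hD : IsOpen D) (hDconn : IsConnected D)
    (hAD : A ⊆ D) (hAclosed : ∀ z ∈ D, z ∈ closure A → z ∈ A)
    (hApolar : PolarSet A)
    (hf : DifferentiableOn ℂ f (D \ A))
    (hnoext : ∀ a ∈ A, ¬ ∃ (V : Set ℂ) (g : ℂ → ℂ), IsOpen V ∧ a ∈ V ∧ V ⊆ D ∧
      DifferentiableOn ℂ g V ∧ Set.EqOn f g (V \ A)) :
    ∃ B : Set ℂ, B ⊆ A ∧ A ⊆ closure B ∧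
      pluripolarHull (graphOver f (D \ A)) (D ×ˢ (Set.univ : Set ℂ)) ∩
        (B ×ˢ (Set.univ : Set ℂ)) = ∅ := by
  refine ⟨{a | a ∈ A ∧ Good D A f a}, fun a ha => ha.1, ?_, ?_⟩
  · intro a0 ha0
    rw [Metric.mem_closure_iff]
    intro δ hδ
    obtain ⟨a, ha, had, hG⟩ := iversen hD hAD hAclosed hApolar hf hnoext ha0 hδ
    exact ⟨a, ⟨ha, hG⟩, by rwa [dist_comm]⟩
  · rw [Set.eq_empty_iff_forall_notMem]
    rintro ⟨a, w⟩ ⟨⟨hΩ, hull⟩, ⟨ha, hG⟩, -⟩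
    choose v h1 h2 h3 h4 using exists_vk hD hAD hAclosed hApolar hf ha hG
    have hpre : IsPreconnected (D ×ˢ (Set.univ : Set ℂ)) :=
      hDconn.isPreconnected.prod isPreconnected_univ
    have hsum : ∀ n, (-2:ℝ) ≤ ∑ k ∈ Finset.range n, v k (a, w) := by
      intro n
      have e1 : ∑ k ∈ Finset.range n, -((1:ℝ) / 2) ^ k ≤ ∑ k ∈ Finset.range n, v k (a, w) :=
        Finset.sum_le_sum fun k _ => h3 k w
      have e2 : ∑ k ∈ Finset.range n, ((1:ℝ) / 2) ^ k ≤ 2 := sum_geometric_two_le n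
      rw [Finset.sum_neg_distrib] at e1
      linarith
    obtain ⟨hpsh, hne⟩ := psh_of_seq hpre (v := v) (ρ := rho D) (fun k p hp => h1 k p hp.1)
      (fun p hp => (rho_cont hD hp.1).continuousWithinAt) (fun k p hp => h2 k p hp.1) hΩ hsum
    refine hne (hull _ hpsh ?_)
    rintro ⟨z, y⟩ ⟨hz, hy⟩
    simp only at hz hy
    subst hy
    have hpos : 0 < infDist z A := by
      rw [← (Metric.infDist_pos_iff_notMem_closure ⟨a, ha⟩)]
      exact fun h => hz.2 (hAclosed z hz.1 h)
    obtain ⟨m1, hm1⟩ := exists_nat_ge (rho D (a, 0))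
    obtain ⟨m2, hm2⟩ := exists_nat_ge (rho D (z, f z) + 1)
    obtain ⟨m3, hm3⟩ := exists_nat_one_div_lt hpos
    refine limU_bot (m := max m1 (max m2 m3)) fun k hk => ?_
    have k1 : (m1:ℝ) ≤ k := by exact_mod_cast (le_max_left _ _).trans hk
    have k2 : (m2:ℝ) ≤ k := by exact_mod_cast ((le_max_left _ _).trans (le_max_right _ _)).trans hk
    have k3 : (m3:ℝ) ≤ k := by exact_mod_cast ((le_max_right _ _).trans (le_max_right _ _)).trans hk
    refine h4 k z hz (hm1.trans k1) (by linarith) (le_trans ?_ hm3.le)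
    gcongr

end PH
end

/-- If `f` is holomorphic on `D \ A` and does not extend holomorphically
to any point of the closed polar set `A ⊆ D`, then there is a subset `B ⊆ A`, dense in `A`,
with `(Γ_f)*_{D×ℂ} ∩ (B × ℂ) = ∅`. -/
theorem statement17 (D A : Set ℂ) (f : ℂ → ℂ)
    (hD : IsOpen D) (hDconn : IsConnected D)
    (hAD : A ⊆ D) (hAclosed : ∀ z ∈ D, z ∈ closure A → z ∈ A)
    (hApolar : PolarSet A)
    (hf : DifferentiableOn ℂ f (D \ A))
    (hnoext : ∀ a ∈ A, ¬ ∃ (V : Set ℂ) (g : ℂ → ℂ), IsOpen V ∧ a ∈ V ∧ V ⊆ D ∧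
      DifferentiableOn ℂ g V ∧ Set.EqOn f g (V \ A)) :
    ∃ B : Set ℂ, B ⊆ A ∧ A ⊆ closure B ∧
      pluripolarHull (graphOver f (D \ A)) (D ×ˢ (Set.univ : Set ℂ)) ∩
        (B ×ˢ (Set.univ : Set ℂ)) = ∅ := by
  exact PH.final D A f hD hDconn hAD hAclosed hApolar hf hnoext
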